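/- arXiv:2110.06551 — 3 statements merged into one kernel-verified Lean document; each statement's English description precedes it below -/
import Mathlib

section
/- An SCF f: Θ → X is implementable in mixed-strategy Nash equilibria by a finite mechanism if and only if f satisfies Maskin monotonicity. -/
/-!
STATEMENT 0: An SCF f : Θ → X is implementable in mixed-strategy Nash equilibria by a
finite mechanism if and only if f satisfies Maskin monotonicity.

Environment: agents `Fin I` with `2 ≤ I`, finite state space `Θ`, set `A` of pure
alternatives, outcome space `X = Δ(A) × ℝ^I` where `Δ(A)` is the set of countably
supported lotteries on `A` (modelled by `PMF A`).  Agent `i`'s utility from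
`x = (ℓ, t)` at state `θ` is `ũ_i(x,θ) = v_i(ℓ,θ) + t_i`, where `v_i(·,θ)` is the
bounded expected-utility function with Bernoulli utilities `w i · θ`.
-/

open scoped BigOperators Classical

noncomputable section

/-- The outcome space `X = Δ(A) × ℝ^I`. -/
abbrev Outc (A : Type) (I : ℕ) : Type := PMF A × (Fin I → ℝ)

/-- Expected utility of a countably supported lottery under Bernoulli utility `w`. -/
def eu {A : Type} (w : A → ℝ) (ℓ : PMF A) : ℝ := ∑' a, (ℓ a).toReal * w a

/-- Agent `i`'s quasilinear utility `ũ_i(x,θ) = v_i(ℓ,θ) + t_i`. -/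
def uT {A Θ : Type} {I : ℕ} (w : Fin I → A → Θ → ℝ) (i : Fin I) (x : Outc A I) (θ : Θ) : ℝ :=
  eu (fun a => w i a θ) x.1 + x.2 i

/-- Maskin monotonicity of an SCF `f : Θ → X`. -/
def MaskinMonotone {A Θ : Type} {I : ℕ} (w : Fin I → A → Θ → ℝ) (f : Θ → Outc A I) : Prop :=
  ∀ θ' θ : Θ, f θ' ≠ f θ →
    ∃ (i : Fin I) (x : Outc A I),
      uT w i x θ' ≤ uT w i (f θ') θ' ∧ uT w i (f θ') θ < uT w i x θ

/-- A finite mechanism: nonempty finite message sets, an outcome function and transfer rules. -/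
structure FinMech (A : Type) (I : ℕ) where
  M : Fin I → Type
  fintypeM : ∀ i, Fintype (M i)
  nonemptyM : ∀ i, Nonempty (M i)
  g : (∀ i, M i) → Outc A I
  τ : Fin I → (∀ i, M i) → ℝ

attribute [instance] FinMech.fintypeM FinMech.nonemptyM

variable {A Θ : Type} {I : ℕ}

/-- Agent `i`'s payoff in the complete-information game `Γ(𝓜,θ)`. -/
def payoff (w : Fin I → A → Θ → ℝ) (𝓜 : FinMech A I) (θ : Θ) (i : Fin I)
    (m : ∀ j, 𝓜.M j) : ℝ :=
  uT w i (𝓜.g m) θ + 𝓜.τ i m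

/-- A mixed-strategy profile: each `σ i` is a probability distribution on `M i`. -/
def IsMixedProfile (𝓜 : FinMech A I) (σ : ∀ i, 𝓜.M i → ℝ) : Prop :=
  ∀ i, (∀ mi, 0 ≤ σ i mi) ∧ (∑ mi, σ i mi) = 1

/-- Expected payoff to agent `i` from the pure message `mi` against `σ_{-i}`. -/
def expPay (w : Fin I → A → Θ → ℝ) (𝓜 : FinMech A I) (θ : Θ)
    (σ : ∀ i, 𝓜.M i → ℝ) (i : Fin I) (mi : 𝓜.M i) : ℝ :=
  ∑ m : ∀ j, 𝓜.M j,
    (∏ j ∈ Finset.univ.erase i, σ j (m j)) * (if m i = mi then payoff w 𝓜 θ i m else 0)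

/-- Mixed-strategy Nash equilibrium of `Γ(𝓜,θ)`: every message in the support of `σ i`
is a best response against `σ_{-i}`. -/
def IsNE (w : Fin I → A → Θ → ℝ) (𝓜 : FinMech A I) (θ : Θ)
    (σ : ∀ i, 𝓜.M i → ℝ) : Prop :=
  IsMixedProfile 𝓜 σ ∧
    ∀ (i : Fin I) (mi : 𝓜.M i), 0 < σ i mi → ∀ mi' : 𝓜.M i,
      expPay w 𝓜 θ σ i mi' ≤ expPay w 𝓜 θ σ i mi

/-- Pure-strategy Nash equilibrium of `Γ(𝓜,θ)`. -/
def IsPureNE (w : Fin I → A → Θ → ℝ) (𝓜 : FinMech A I) (θ : Θ)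
    (m : ∀ j, 𝓜.M j) : Prop :=
  ∀ (i : Fin I) (mi' : 𝓜.M i),
    payoff w 𝓜 θ i (Function.update m i mi') ≤ payoff w 𝓜 θ i m

/-- `m` is played with positive probability under some mixed-strategy Nash equilibrium. -/
def InSuppNE (w : Fin I → A → Θ → ℝ) (𝓜 : FinMech A I) (θ : Θ)
    (m : ∀ j, 𝓜.M j) : Prop :=
  ∃ σ, IsNE w 𝓜 θ σ ∧ 0 < ∏ i, σ i (m i)

/-- Implementability in mixed-strategy Nash equilibria by a finite mechanism
(Definition 1 of the paper). -/
def NashImplementable (w : Fin I → A → Θ → ℝ) (f : Θ → Outc A I) : Prop :=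
  ∃ 𝓜 : FinMech A I, ∀ θ : Θ,
    (∃ m, IsPureNE w 𝓜 θ m) ∧
    ∀ m, InSuppNE w 𝓜 θ m → 𝓜.g m = f θ ∧ ∀ i, 𝓜.τ i m = 0

/-! ### Finite mixtures and money -/

/-- The outcome obtained by drawing one of the outcomes `o k` with probability `p k`. -/
def mix {K : Type} [Fintype K] (p : PMF K) (o : K → Outc A I) : Outc A I :=
  (p.bind fun k => (o k).1, fun i => ∑ k, (p k).toReal * (o k).2 i)

lemma sum_toReal_pmf {K : Type} [Fintype K] (p : PMF K) : ∑ k, (p k).toReal = 1 := by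
  have h := p.tsum_coe
  rw [tsum_fintype] at h
  rw [← ENNReal.toReal_sum fun k _ => p.apply_ne_top k, h, ENNReal.toReal_one]

lemma mix_const {K : Type} [Fintype K] (p : PMF K) (x : Outc A I) :
    mix p (fun _ => x) = x := by
  ext1
  · exact p.bind_const x.1
  · funext i
    simp [mix, ← Finset.sum_mul, sum_toReal_pmf]

lemma summable_eu {u : A → ℝ} {B : ℝ} (hu : ∀ a, |u a| ≤ B) (ℓ : PMF A) :
    Summable fun a => (ℓ a).toReal * u a := by
  have hℓ : Summable fun a => (ℓ a).toReal := ENNReal.summable_toReal ℓ.tsum_coe_ne_top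
  refine Summable.of_norm_bounded (hℓ.mul_right B) fun a => ?_
  rw [Real.norm_eq_abs, abs_mul, abs_of_nonneg ENNReal.toReal_nonneg]
  exact mul_le_mul_of_nonneg_left (hu a) ENNReal.toReal_nonneg

lemma eu_bind {K : Type} [Fintype K] {u : A → ℝ} {B : ℝ} (hu : ∀ a, |u a| ≤ B)
    (p : PMF K) (q : K → PMF A) :
    eu u (p.bind q) = ∑ k, (p k).toReal * eu u (q k) := by
  have h : ∀ a, ((p.bind q) a).toReal * u a =
      ∑ k, (p k).toReal * ((q k a).toReal * u a) := by
    intro a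
    rw [PMF.bind_apply, tsum_fintype, ENNReal.toReal_sum, Finset.sum_mul]
    · simp [ENNReal.toReal_mul, mul_assoc]
    · exact fun k _ => ENNReal.mul_ne_top (p.apply_ne_top k) ((q k).apply_ne_top a)
  simp only [eu, h]
  have hs : ∀ k ∈ Finset.univ, Summable fun a => (p k).toReal * ((q k a).toReal * u a) :=
    fun k _ => (summable_eu hu (q k)).mul_left _
  rw [Summable.tsum_finsetSum hs]
  simp only [tsum_mul_left]

lemma uT_mix {K : Type} [Fintype K] {w : Fin I → A → Θ → ℝ} {B : ℝ}
    (hB : ∀ i a θ, |w i a θ| ≤ B) (p : PMF K) (o : K → Outc A I) (i : Fin I) (θ : Θ) :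
    uT w i (mix p o) θ = ∑ k, (p k).toReal * uT w i (o k) θ := by
  simp only [uT, mix, eu_bind (fun a => hB i a θ), mul_add, Finset.sum_add_distrib]

/-- The outcome `x` together with an extra payment `c` to every agent. -/
def pay (x : Outc A I) (c : ℝ) : Outc A I := (x.1, fun i => x.2 i + c)

lemma uT_pay (w : Fin I → A → Θ → ℝ) (i : Fin I) (x : Outc A I) (c : ℝ) (θ : Θ) :
    uT w i (pay x c) θ = uT w i x θ + c := by
  simp [uT, pay, add_assoc]

lemma exists_uT_eq_convexComb {w : Fin I → A → Θ → ℝ} {B : ℝ}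
    (hB : ∀ i a θ, |w i a θ| ≤ B) (x y : Outc A I) {ε : ℝ} (h0 : 0 ≤ ε) (h1 : ε ≤ 1) :
    ∃ z : Outc A I, ∀ i θ, uT w i z θ = (1 - ε) * uT w i x θ + ε * uT w i y θ := by
  have hsum : ∑ b : Bool, (if b then ENNReal.ofReal ε else ENNReal.ofReal (1 - ε)) = 1 := by
    rw [Fintype.sum_bool]
    simp only [if_true, Bool.false_eq_true, if_false]
    rw [← ENNReal.ofReal_add h0 (by linarith)]
    simp
  refine ⟨mix (PMF.ofFintype _ hsum) (fun b => if b then y else x), fun i θ => ?_⟩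
  rw [uT_mix hB]
  simp [ENNReal.toReal_ofReal, h0, h1, add_comm]

/-! ### Strictly separating menus and challenges -/

section Menus

open scoped Topology

variable {T : Type} [Fintype T] {w : Fin I → A → Θ → ℝ} {B : ℝ}

/-- Finitely many pairwise distinct preferences can be strictly separated by a menu. -/
lemma exists_separating_menu [Nonempty A] (hB : ∀ i a θ, |w i a θ| ≤ B) (j : Fin I) (r : T → Θ)
    (hr : ∀ t t', t ≠ t' → ¬ ∃ c, ∀ x, uT w j x (r t) = uT w j x (r t') + c) :
    ∃ y : T → Outc A I, ∀ t t', t' ≠ t → uT w j (y t') (r t) < uT w j (y t) (r t) := by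
  rcases isEmpty_or_nonempty T with hT | hT
  · exact ⟨fun t => (hT.false t).elim, fun t => (hT.false t).elim⟩
  let x₀ : Outc A I := (PMF.pure (Classical.arbitrary A), 0)
  have hsep : ∀ k : T × T, ∃ x : Outc A I, k.1 ≠ k.2 →
      uT w j x (r k.1) - uT w j x₀ (r k.1) ≠ uT w j x (r k.2) - uT w j x₀ (r k.2) := by
    intro k
    by_cases hk : k.1 = k.2
    · exact ⟨x₀, fun h => absurd hk h⟩
    by_contra! hcon
    refine hr k.1 k.2 hk ⟨uT w j x₀ (r k.1) - uT w j x₀ (r k.2), fun x => ?_⟩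
    linarith [(hcon x).2]
  choose x hx using hsep
  let gain : T × T → T → ℝ := fun k t => uT w j (x k) (r t) - uT w j x₀ (r t)
  let price : T × T → ℝ := fun k => (gain k k.1 + gain k k.2) / 2
  let pick : T → T × T → Outc A I := fun t k =>
    if price k ≤ gain k t then pay (x k) (-price k) else x₀
  have hpick : ∀ t k s, uT w j (pick t k) (r s) =
      uT w j x₀ (r s) + if price k ≤ gain k t then gain k s - price k else 0 := by
    intro t k s
    by_cases h : price k ≤ gain k t
    · simp only [pick, h, if_true, uT_pay, gain]; ring
    · simp only [pick, h, if_false, add_zero]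
  refine ⟨fun t => mix (PMF.uniformOfFintype (T × T)) (pick t), fun t t' hne => ?_⟩
  have hpos : ∀ k, 0 < (PMF.uniformOfFintype (T × T) k).toReal := fun k =>
    ENNReal.toReal_pos ((PMF.mem_support_iff _ _).1 (PMF.mem_support_uniformOfFintype k))
      (PMF.apply_ne_top _ k)
  rw [uT_mix hB, uT_mix hB]
  refine Finset.sum_lt_sum (fun k _ => mul_le_mul_of_nonneg_left ?_ (hpos k).le)
    ⟨(t, t'), Finset.mem_univ _, mul_lt_mul_of_pos_left ?_ (hpos _)⟩
  · rw [hpick, hpick]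
    split_ifs <;> linarith
  · have h : gain (t, t') t ≠ gain (t, t') t' := hx (t, t') hne.symm
    rw [hpick, hpick]
    have hp : price (t, t') = (gain (t, t') t + gain (t, t') t') / 2 := rfl
    rcases lt_or_gt_of_ne h with h | h <;> split_ifs <;> linarith

/-- Every type that prefers, to the benchmark `x₀`, some outcome that `t₀` finds no better than
`x₀` can be given a challenge, so that all types strictly prefer their own assignment. -/
lemma exists_challenge [Nonempty A] (hB : ∀ i a θ, |w i a θ| ≤ B) (j : Fin I) (r : T → Θ)
    {y : T → Outc A I} (hy : ∀ t t', t' ≠ t → uT w j (y t') (r t) < uT w j (y t) (r t))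
    (x₀ : Outc A I) (t₀ : T) :
    ∃ z : T → Outc A I, z t₀ = x₀ ∧
      (∀ t t', t' ≠ t → (z t' = x₀ ∧ z t = x₀) ∨ uT w j (z t') (r t) < uT w j (z t) (r t)) ∧
      ∀ t, z t = x₀ → ∀ x, uT w j x (r t₀) ≤ uT w j x₀ (r t₀) →
        uT w j x (r t) ≤ uT w j x₀ (r t) := by
  let C : Set T := {t | ∃ x, uT w j x (r t₀) ≤ uT w j x₀ (r t₀) ∧
    uT w j x₀ (r t) < uT w j x (r t)}
  have hx : ∀ t : C, ∃ x, uT w j x (r t₀) < uT w j x₀ (r t₀) ∧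
      uT w j x₀ (r t) < uT w j x (r t) := by
    rintro ⟨t, x, h1, h2⟩
    refine ⟨pay x (-((uT w j x (r t) - uT w j x₀ (r t)) / 2)), ?_, ?_⟩ <;> rw [uT_pay] <;>
      linarith
  choose x hx0 hx1 using hx
  have hxC : ∀ t ∉ C, ∀ s : C, uT w j (x s) (r t) < uT w j x₀ (r t) := by
    intro t ht s
    by_contra! hle
    refine ht ⟨pay (x s) (uT w j x₀ (r t₀) - uT w j (x s) (r t₀)), ?_, ?_⟩ <;> rw [uT_pay] <;>
      linarith [hx0 s]
  have hbest : ∀ t : C, ∃ s : C, ∀ s' : C, uT w j (x s') (r t) ≤ uT w j (x s) (r t) := by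
    intro t
    have : Nonempty C := ⟨t⟩
    exact Finite.exists_max fun s : C => uT w j (x s) (r t)
  choose b hb using hbest
  have hev : ∀ α β γ : ℝ, α < β → ∀ᶠ ε in 𝓝[>] (0 : ℝ), (1 - ε) * α + ε * γ < β := by
    intro α β γ h
    have hcont : Continuous fun ε : ℝ => (1 - ε) * α + ε * γ := by fun_prop
    have htend := (hcont.tendsto 0).mono_left (nhdsWithin_le_nhds (s := Set.Ioi 0))
    exact htend.eventually_lt_const (by simpa using h)
  have hup : ∀ᶠ ε in 𝓝[>] (0 : ℝ), ∀ t : C,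
      (1 - ε) * (-uT w j (x (b t)) (r t)) + ε * (-uT w j (y t) (r t)) < -uT w j x₀ (r t) :=
    Filter.eventually_all.2 fun t => hev _ _ _ (neg_lt_neg ((hx1 t).trans_le (hb t t)))
  have hdown : ∀ᶠ ε in 𝓝[>] (0 : ℝ), ∀ (t : {t // t ∉ C}) (s : C),
      (1 - ε) * uT w j (x (b s)) (r t) + ε * uT w j (y s) (r t) < uT w j x₀ (r t) :=
    Filter.eventually_all.2 fun t => Filter.eventually_all.2 fun s =>
      hev _ _ _ (hxC t t.2 (b s))
  have hone : ∀ᶠ ε in 𝓝[>] (0 : ℝ), ε < 1 :=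
    (eventually_lt_nhds one_pos).filter_mono nhdsWithin_le_nhds
  obtain ⟨ε, ⟨⟨hup, hdown⟩, hε1⟩, hε0⟩ :=
    (((hup.and hdown).and hone).and self_mem_nhdsWithin).exists
  have hε0 : 0 < ε := hε0
  choose v hv using fun s : C =>
    exists_uT_eq_convexComb hB (x (b s)) (y s) hε0.le hε1.le
  have hgt : ∀ t : C, uT w j x₀ (r t) < uT w j (v t) (r t) := by
    intro t
    rw [hv]
    linarith [hup t]
  refine ⟨fun t => if h : t ∈ C then v ⟨t, h⟩ else x₀, ?_, fun t t' hne => ?_, ?_⟩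
  · exact dif_neg fun ⟨x, h1, h2⟩ => h2.not_ge h1
  · by_cases h : t ∈ C <;> by_cases h' : t' ∈ C <;> simp only [h, h', dif_pos, dif_neg,
      not_false_eq_true]
    · right
      rw [hv, hv]
      exact add_lt_add_of_le_of_lt
        (mul_le_mul_of_nonneg_left (hb ⟨t, h⟩ _) (by linarith))
        (mul_lt_mul_of_pos_left (hy t t' hne) hε0)
    · exact Or.inr (hgt ⟨t, h⟩)
    · right
      rw [hv]
      exact hdown ⟨t, h⟩ ⟨t', h'⟩
    · exact Or.inl ⟨trivial, trivial⟩
  · intro t ht x' hx'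
    by_cases h : t ∈ C
    · have := hgt ⟨t, h⟩
      simp only [h, dif_pos] at ht
      rw [ht] at this
      exact absurd this (lt_irrefl _)
    · exact not_lt.1 fun hlt => h ⟨x', hx', hlt⟩

end Menus

/-- Outcomes `ζ j s t` assigned to agent `j` claiming type `t`, when the agents do not agree on a
state (`s = none`) or agree on the state `θ'` (`s = some θ'`), for which it is optimal to claim
the true type `ν j θ`. -/
structure IsChallengeScheme (w : Fin I → A → Θ → ℝ) (f : Θ → Outc A I) {T : Fin I → Type}
    (ν : ∀ j, Θ → T j) (ζ : ∀ j, Option Θ → T j → Outc A I) : Prop where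
  none_lt : ∀ j θ t, t ≠ ν j θ → uT w j (ζ j none t) θ < uT w j (ζ j none (ν j θ)) θ
  some_eq_or_lt : ∀ j θ' θ t, t ≠ ν j θ →
    (ζ j (some θ') t = f θ' ∧ ζ j (some θ') (ν j θ) = f θ') ∨
      uT w j (ζ j (some θ') t) θ < uT w j (ζ j (some θ') (ν j θ)) θ
  some_self : ∀ j θ', ζ j (some θ') (ν j θ') = f θ'
  eq_of_unchallenged : ∀ θ' θ, (∀ j, ζ j (some θ') (ν j θ) = f θ') → f θ' = f θ

lemma IsChallengeScheme.truth_le {w : Fin I → A → Θ → ℝ} {f : Θ → Outc A I} {T : Fin I → Type}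
    {ν : ∀ j, Θ → T j} {ζ : ∀ j, Option Θ → T j → Outc A I} (h : IsChallengeScheme w f ν ζ)
    (j : Fin I) (s : Option Θ) (θ : Θ) (t : T j) :
    uT w j (ζ j s t) θ ≤ uT w j (ζ j s (ν j θ)) θ := by
  by_cases ht : t = ν j θ
  · rw [ht]
  rcases s with _ | θ'
  · exact (h.none_lt j θ t ht).le
  · rcases h.some_eq_or_lt j θ' θ t ht with h | h
    · rw [h.1, h.2]
    · exact h.le

lemma MaskinMonotone.exists_isChallengeScheme [Fintype Θ] [Nonempty A]
    {w : Fin I → A → Θ → ℝ} {B : ℝ} (hB : ∀ i a θ, |w i a θ| ≤ B) {f : Θ → Outc A I}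
    (hf : MaskinMonotone w f) :
    ∃ (T : Fin I → Type) (_ : ∀ j, Fintype (T j)) (ν : ∀ j, Θ → T j)
      (ζ : ∀ j, Option Θ → T j → Outc A I), IsChallengeScheme w f ν ζ := by
  let S : Fin I → Setoid Θ := fun j =>
    { r := fun θ θ' => ∃ c, ∀ x, uT w j x θ = uT w j x θ' + c
      iseqv :=
        { refl := fun θ => ⟨0, fun x => by ring⟩
          symm := fun ⟨c, h⟩ => ⟨-c, fun x => by rw [h x]; ring⟩
          trans := fun ⟨c, h⟩ ⟨d, k⟩ => ⟨d + c, fun x => by rw [h x, k x]; ring⟩ } }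
  let T : Fin I → Type := fun j => Quotient (S j)
  let ν : ∀ j, Θ → T j := fun j θ => Quotient.mk (S j) θ
  have : ∀ j, Fintype (T j) := fun j => Fintype.ofFinite _
  have hout : ∀ j θ, ∃ c, ∀ x, uT w j x (ν j θ).out = uT w j x θ + c := fun j θ =>
    Quotient.exact (s := S j) (Quotient.out_eq (ν j θ))
  have hlt : ∀ j θ x y, uT w j x (ν j θ).out < uT w j y (ν j θ).out ↔
      uT w j x θ < uT w j y θ := by
    intro j θ x y
    obtain ⟨c, hc⟩ := hout j θ
    rw [hc, hc, add_lt_add_iff_right]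
  have hdict : ∀ j, ∃ y : T j → Outc A I, ∀ t t', t' ≠ t →
      uT w j (y t') t.out < uT w j (y t) t.out := by
    refine fun j => exists_separating_menu hB j (fun t : T j => t.out) fun t t' hne h => hne ?_
    rw [← Quotient.out_eq t, ← Quotient.out_eq t']
    exact Quotient.sound (s := S j) h
  choose y hy using hdict
  choose z hz0 hz1 hz2 using fun j (θ' : Θ) =>
    exists_challenge hB j (fun t : T j => t.out) (hy j) (f θ') (ν j θ')
  refine ⟨T, inferInstance, ν, fun j s => s.elim (y j) (z j), ?_, ?_, ?_, ?_⟩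
  · exact fun j θ t ht => (hlt j θ _ _).1 (hy j _ _ ht)
  · exact fun j θ' θ t ht => (hz1 j θ' _ _ ht).imp id (hlt j θ _ _).1
  · exact hz0
  · intro θ' θ h
    by_contra hne
    obtain ⟨j, x, hle, hgt⟩ := hf θ' θ hne
    have := hz2 j θ' (ν j θ) (h j) x (not_lt.1 fun hc => ((hlt j θ' _ _).1 hc).not_ge hle)
    exact this.not_gt ((hlt j θ _ _).2 hgt)

/-! ### Mixed equilibria of finite mechanisms -/

section Equilibrium

variable {w : Fin I → A → Θ → ℝ} {𝓜 : FinMech A I} {θ : Θ}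

lemma expPay_eq_sum_update (w : Fin I → A → Θ → ℝ) (θ : Θ) (σ : ∀ i, 𝓜.M i → ℝ) (i : Fin I)
    (mi mi' : 𝓜.M i) :
    expPay w 𝓜 θ σ i mi' = ∑ m : ∀ j, 𝓜.M j with m i = mi,
      (∏ j ∈ Finset.univ.erase i, σ j (m j)) * payoff w 𝓜 θ i (Function.update m i mi') := by
  simp only [expPay, mul_ite, mul_zero]
  rw [← Finset.sum_filter]
  refine Finset.sum_bij' (fun m _ => Function.update m i mi) (fun m _ => Function.update m i mi')
    (by simp) (by simp) ?_ ?_ ?_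
  · intro m hm
    simp [← (Finset.mem_filter.1 hm).2]
  · intro m hm
    simp [← (Finset.mem_filter.1 hm).2]
  · intro m hm
    have hW : ∏ j ∈ Finset.univ.erase i, σ j (Function.update m i mi j) =
        ∏ j ∈ Finset.univ.erase i, σ j (m j) :=
      Finset.prod_congr rfl fun j hj => by rw [Function.update_of_ne (Finset.ne_of_mem_erase hj)]
    rw [hW, Function.update_idem, ← (Finset.mem_filter.1 hm).2, Function.update_eq_self]

/-- In equilibrium no deviation weakly dominates, on the support, a message that is played. -/
lemma IsNE.payoff_update_le {σ : ∀ i, 𝓜.M i → ℝ} (hσ : IsNE w 𝓜 θ σ) {i : Fin I}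
    {mi mi' : 𝓜.M i}
    (hle : ∀ m, (∀ j, 0 < σ j (m j)) → m i = mi →
      payoff w 𝓜 θ i m ≤ payoff w 𝓜 θ i (Function.update m i mi'))
    {m : ∀ j, 𝓜.M j} (hm : ∀ j, 0 < σ j (m j)) (hmi : m i = mi) :
    payoff w 𝓜 θ i (Function.update m i mi') ≤ payoff w 𝓜 θ i m := by
  by_contra! hlt
  have hi : 0 < σ i mi := hmi ▸ hm i
  refine (hσ.2 i mi hi mi').not_gt ?_
  rw [expPay_eq_sum_update w θ σ i mi mi, expPay_eq_sum_update w θ σ i mi mi']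
  have hself : ∀ n : ∀ j, 𝓜.M j, n i = mi → Function.update n i mi = n := by
    rintro n rfl
    exact Function.update_eq_self i n
  refine Finset.sum_lt_sum (fun n hn => ?_) ⟨m, by simpa using hmi, ?_⟩
  · have hn : n i = mi := (Finset.mem_filter.1 hn).2
    rw [hself n hn]
    by_cases hpos : ∀ j, 0 < σ j (n j)
    · exact mul_le_mul_of_nonneg_left (hle n hpos hn)
        (Finset.prod_nonneg fun j _ => (hpos j).le)
    · push Not at hpos
      obtain ⟨j, hj⟩ := hpos
      have hji : j ≠ i := by
        rintro rfl
        rw [hn] at hj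
        exact hi.not_ge hj
      rw [Finset.prod_eq_zero (Finset.mem_erase.2 ⟨hji, Finset.mem_univ j⟩)
        (le_antisymm hj ((hσ.1 j).1 _))]
      simp
  · rw [hself m hmi]
    exact mul_lt_mul_of_pos_left hlt (Finset.prod_pos fun j _ => hm j)

lemma IsMixedProfile.exists_pos {σ : ∀ i, 𝓜.M i → ℝ} (hσ : IsMixedProfile 𝓜 σ) :
    ∃ m : ∀ j, 𝓜.M j, ∀ j, 0 < σ j (m j) := by
  have h : ∀ j, ∃ n, 0 < σ j n := by
    intro j
    by_contra! hle
    linarith [(hσ j).2, Finset.sum_nonpos fun n (_ : n ∈ Finset.univ) => hle n]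
  choose m hm using h
  exact ⟨m, hm⟩

lemma IsPureNE.inSuppNE {m : ∀ j, 𝓜.M j} (hm : IsPureNE w 𝓜 θ m) : InSuppNE w 𝓜 θ m := by
  let σ : ∀ i, 𝓜.M i → ℝ := fun i mi => if mi = m i then 1 else 0
  have hexp : ∀ i mi, expPay w 𝓜 θ σ i mi = payoff w 𝓜 θ i (Function.update m i mi) := by
    intro i mi
    rw [expPay_eq_sum_update w θ σ i (m i) mi, Finset.sum_eq_single m]
    · simp [σ]
    · intro n hn hne
      obtain ⟨j, hj⟩ := Function.ne_iff.1 hne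
      have hji : j ≠ i := by
        rintro rfl
        exact hj (Finset.mem_filter.1 hn).2
      rw [Finset.prod_eq_zero (Finset.mem_erase.2 ⟨hji, Finset.mem_univ j⟩) (by simp [σ, hj])]
      simp
    · simp
  refine ⟨σ, ⟨fun i => ⟨fun mi => ?_, by simp [σ]⟩, fun i mi hmi mi' => ?_⟩, by simp [σ]⟩
  · dsimp only [σ]; split_ifs <;> norm_num
  · have hmi : mi = m i := by
      by_contra h
      simp [σ, h] at hmi
    rw [hexp, hexp, hmi, Function.update_eq_self]
    exact hm i mi'

end Equilibrium

lemma NashImplementable.maskinMonotone {w : Fin I → A → Θ → ℝ} {f : Θ → Outc A I}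
    (h : NashImplementable w f) : MaskinMonotone w f := by
  obtain ⟨𝓜, h𝓜⟩ := h
  intro θ' θ hne
  obtain ⟨m, hm⟩ := (h𝓜 θ').1
  obtain ⟨hg, hτ⟩ := (h𝓜 θ').2 m hm.inSuppNE
  have hnot : ¬ IsPureNE w 𝓜 θ m := fun hm' => hne (hg.symm.trans ((h𝓜 θ).2 m hm'.inSuppNE).1)
  simp only [IsPureNE, not_forall, not_le] at hnot
  obtain ⟨i, mi, hlt⟩ := hnot
  have hle := hm i mi
  simp only [payoff, hg, hτ, add_zero] at hlt hle
  exact ⟨i, pay (𝓜.g (Function.update m i mi)) (𝓜.τ i (Function.update m i mi)),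
    by rwa [uT_pay], by rwa [uT_pay]⟩

/-! ### The implementing mechanism -/

section Mechanism

variable {T : Fin I → Type}

/-- The state on which the reported type profiles `q i` agree, if there is one. -/
def agreedState (ν : ∀ j, Θ → T j) (q : Fin I → ∀ j, T j) : Option Θ :=
  if h : ∃ θ, ∀ i, q i = fun j => ν j θ then some h.choose else none

lemma agreedState_of_forall {ν : ∀ j, Θ → T j} {q : Fin I → ∀ j, T j} {θ : Θ}
    (h : ∀ i, q i = fun j => ν j θ) :
    ∃ θ', agreedState ν q = some θ' ∧ ∀ i, q i = fun j => ν j θ' := by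
  have h' : ∃ θ, ∀ i, q i = fun j => ν j θ := ⟨θ, h⟩
  exact ⟨h'.choose, dif_pos h', h'.choose_spec⟩

lemma agreedState_eq_none {ν : ∀ j, Θ → T j} {q : Fin I → ∀ j, T j}
    (h : ¬ ∃ θ, ∀ i, q i = fun j => ν j θ) : agreedState ν q = none :=
  dif_neg h

/-- The transfer to agent `i` reporting the type profile `p` that is due to the message `n` of
agent `j`: a bet on the type `j` claims, and a fine for disagreeing on `i`'s own type. -/
def crossCheck (H : ℝ) (i j : Fin I) (p : ∀ k, T k) (n : T j × ∀ k, T k) : ℝ :=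
  H * ((if p j = n.1 then 1 else 0) - (if n.2 j = n.1 then 1 else 0)) -
    H * (if p i = n.2 i then 0 else 1)

/-- Agents claim a type and report a type profile. A uniformly drawn agent's claim determines
the outcome, and reports are cross-checked at stake `H`. -/
@[reducible] def crossCheckMech [Nonempty (Fin I)] [∀ j, Fintype (T j)] [∀ j, Nonempty (T j)]
    (ν : ∀ j, Θ → T j) (ζ : ∀ j, Option Θ → T j → Outc A I) (H : ℝ) : FinMech A I where
  M i := T i × ∀ k, T k
  fintypeM _ := inferInstance
  nonemptyM _ := inferInstance
  g m := mix (PMF.uniformOfFintype (Fin I))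
    fun k => ζ k (agreedState ν fun i => (m i).2) (m k).1
  τ i m := ∑ j ∈ Finset.univ.erase i, crossCheck H i j (m i).2 (m j)

lemma crossCheck_self (H : ℝ) (i j : Fin I) (n : T j × ∀ k, T k) : crossCheck H i j n.2 n = 0 := by
  simp [crossCheck]

lemma crossCheck_honest (H : ℝ) (i j : Fin I) (p q : ∀ k, T k) :
    crossCheck H i j q (p j, p) =
      -(H * (if q j = p j then 0 else 1)) - H * (if q i = p i then 0 else 1) := by
  by_cases h : q j = p j <;> simp [crossCheck, h]

lemma crossCheck_update_of_ne (H : ℝ) {i j k : Fin I} (hi : i ≠ j) (hk : k ≠ j) (p : ∀ k, T k)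
    (t : T j) (n : T k × ∀ k, T k) :
    crossCheck H i k (Function.update p j t) n = crossCheck H i k p n := by
  simp [crossCheck, hi, hk]

lemma crossCheck_update_claim (H : ℝ) {i j : Fin I} (hi : i ≠ j) {p : ∀ k, T k}
    {n : T j × ∀ k, T k} (hp : p j ≠ n.1) :
    crossCheck H i j (Function.update p j n.1) n = crossCheck H i j p n + H := by
  simp only [crossCheck, Function.update_self, Function.update_of_ne hi, hp, if_true, if_false]
  ring

lemma crossCheck_update_own (H : ℝ) {i k : Fin I} (hk : k ≠ i) {p : ∀ k, T k}
    {n : T k × ∀ k, T k} (hp : p i ≠ n.2 i) :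
    crossCheck H i k (Function.update p i (n.2 i)) n = crossCheck H i k p n + H := by
  simp only [crossCheck, Function.update_self, Function.update_of_ne hk, hp, if_true, if_false]
  ring

variable [Nonempty (Fin I)] [∀ j, Fintype (T j)] [∀ j, Nonempty (T j)]
  {ν : ∀ j, Θ → T j} {ζ : ∀ j, Option Θ → T j → Outc A I} {w : Fin I → A → Θ → ℝ}

/-- Gaining `H` in transfers makes up for every possible change of the outcome. -/
def IsDecisiveStake (w : Fin I → A → Θ → ℝ) (ν : ∀ j, Θ → T j)
    (ζ : ∀ j, Option Θ → T j → Outc A I) (H : ℝ) : Prop :=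
  ∀ i θ (m m' : ∀ j, (crossCheckMech ν ζ H).M j),
    (crossCheckMech ν ζ H).τ i m + H ≤ (crossCheckMech ν ζ H).τ i m' →
    payoff w (crossCheckMech ν ζ H) θ i m < payoff w (crossCheckMech ν ζ H) θ i m'

lemma exists_isDecisiveStake [Fintype Θ] (w : Fin I → A → Θ → ℝ) (ν : ∀ j, Θ → T j)
    (ζ : ∀ j, Option Θ → T j → Outc A I) :
    ∃ H : ℝ, 0 < H ∧ IsDecisiveStake w ν ζ H := by
  let u : Fin I × Θ × (∀ i : Fin I, T i × ∀ k, T k) → ℝ := fun k =>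
    |uT w k.1 ((crossCheckMech ν ζ 0).g k.2.2) k.2.1|
  obtain ⟨D, hD⟩ := (Set.finite_range u).bddAbove
  have hD : ∀ k, u k ≤ D := fun k => hD ⟨k, rfl⟩
  refine ⟨2 * |D| + 1, by positivity, fun i θ m m' hτ => ?_⟩
  have h1 := abs_le.1 (hD (i, θ, m))
  have h2 := abs_le.1 (hD (i, θ, m'))
  dsimp only [payoff] at *
  linarith [le_abs_self D, h1.1, h1.2, h2.1, h2.2]

lemma crossCheckMech_τ_add_le {H : ℝ} {i : Fin I}
    {m m' : ∀ j, (crossCheckMech ν ζ H).M j} {k : Fin I} (hk : k ≠ i)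
    (hle : ∀ j ≠ i, crossCheck H i j (m i).2 (m j) ≤ crossCheck H i j (m' i).2 (m' j))
    (hlt : crossCheck H i k (m i).2 (m k) + H ≤ crossCheck H i k (m' i).2 (m' k)) :
    (crossCheckMech ν ζ H).τ i m + H ≤ (crossCheckMech ν ζ H).τ i m' := by
  have hmem : k ∈ Finset.univ.erase i := Finset.mem_erase.2 ⟨hk, Finset.mem_univ k⟩
  dsimp only
  rw [← Finset.add_sum_erase _ _ hmem, ← Finset.add_sum_erase _ _ hmem]
  have := Finset.sum_le_sum fun j (hj : j ∈ (Finset.univ.erase i).erase k) =>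
    hle j (Finset.ne_of_mem_erase (Finset.mem_of_mem_erase hj))
  linarith

lemma payoff_le_payoff_truth {B : ℝ} (hB : ∀ i a θ, |w i a θ| ≤ B) {f : Θ → Outc A I}
    (hζ : IsChallengeScheme w f ν ζ) {H : ℝ} (θ : Θ) (i : Fin I)
    (m : ∀ j, (crossCheckMech ν ζ H).M j) :
    payoff w (crossCheckMech ν ζ H) θ i m ≤
        payoff w (crossCheckMech ν ζ H) θ i (Function.update m i (ν i θ, (m i).2)) ∧
      (uT w i (ζ i (agreedState ν fun j => (m j).2) (m i).1) θ <
          uT w i (ζ i (agreedState ν fun j => (m j).2) (ν i θ)) θ →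
        payoff w (crossCheckMech ν ζ H) θ i m <
          payoff w (crossCheckMech ν ζ H) θ i (Function.update m i (ν i θ, (m i).2))) := by
  set m' : ∀ j, (crossCheckMech ν ζ H).M j := Function.update m i (ν i θ, (m i).2) with hm'
  have hi : m' i = (ν i θ, (m i).2) := Function.update_self ..
  have hj : ∀ j ≠ i, m' j = m j := fun j hj => Function.update_of_ne hj ..
  have h2 : (fun j => (m' j).2) = fun j => (m j).2 := by
    funext j
    by_cases h : j = i
    · subst h; rw [hi]
    · rw [hj j h]
  have hτ : (crossCheckMech ν ζ H).τ i m' = (crossCheckMech ν ζ H).τ i m := by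
    dsimp only
    refine Finset.sum_congr rfl fun j hmem => ?_
    rw [hj j (Finset.ne_of_mem_erase hmem), hi]
  have hpos : ∀ k, 0 < (PMF.uniformOfFintype (Fin I) k).toReal := fun k =>
    ENNReal.toReal_pos ((PMF.mem_support_iff _ _).1 (PMF.mem_support_uniformOfFintype k))
      (PMF.apply_ne_top _ k)
  have hterm : ∀ k, uT w i (ζ k (agreedState ν fun j => (m j).2) (m k).1) θ ≤
      uT w i (ζ k (agreedState ν fun j => (m j).2) (m' k).1) θ := by
    intro k
    by_cases h : k = i
    · subst h
      rw [hi]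
      exact hζ.truth_le k _ θ _
    · rw [hj k h]
  rw [payoff, payoff, hτ, add_le_add_iff_right, add_lt_add_iff_right, uT_mix hB, uT_mix hB, h2]
  refine ⟨Finset.sum_le_sum fun k _ => mul_le_mul_of_nonneg_left (hterm k) (hpos k).le,
    fun hlt => Finset.sum_lt_sum
      (fun k _ => mul_le_mul_of_nonneg_left (hterm k) (hpos k).le)
      ⟨i, Finset.mem_univ i, mul_lt_mul_of_pos_left ?_ (hpos i)⟩⟩
  rw [hi]
  exact hlt

variable {H : ℝ} {θ : Θ} {σ : ∀ i, (crossCheckMech ν ζ H).M i → ℝ}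

lemma IsNE.not_stake_gain (hH : IsDecisiveStake w ν ζ H)
    (hσ : IsNE w (crossCheckMech ν ζ H) θ σ) {i : Fin I}
    {mi mi' : (crossCheckMech ν ζ H).M i} (hi : 0 < σ i mi)
    (hgain : ∀ m, (∀ j, 0 < σ j (m j)) → m i = mi → (crossCheckMech ν ζ H).τ i m + H ≤
      (crossCheckMech ν ζ H).τ i (Function.update m i mi')) : False := by
  obtain ⟨m, hm⟩ := hσ.1.exists_pos
  have hm' : ∀ j, 0 < σ j (Function.update m i mi j) := by
    intro j
    by_cases h : j = i
    · subst h; rwa [Function.update_self]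
    · rw [Function.update_of_ne h]; exact hm j
  have hself : Function.update m i mi i = mi := Function.update_self ..
  exact (hσ.payoff_update_le (fun n hn hni => (hH i θ _ _ (hgain n hn hni)).le) hm'
    hself).not_gt (hH i θ _ _ (hgain _ hm' hself))

lemma IsNE.report_eq_of_claim_eq (hH0 : 0 < H) (hH : IsDecisiveStake w ν ζ H)
    (hσ : IsNE w (crossCheckMech ν ζ H) θ σ) {i j : Fin I} (hij : i ≠ j) {t : T j}
    (ht : ∀ mj, 0 < σ j mj → mj.1 = t) {mi : (crossCheckMech ν ζ H).M i} (hi : 0 < σ i mi) :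
    mi.2 j = t := by
  by_contra hne
  refine hσ.not_stake_gain hH (mi' := (mi.1, Function.update mi.2 j t)) hi fun m hm hmi => ?_
  have hj := ht _ (hm j)
  subst hmi
  have hstep : crossCheck H i j (Function.update (m i).2 j t) (m j) =
      crossCheck H i j (m i).2 (m j) + H := by
    rw [← hj] at hne ⊢
    exact crossCheck_update_claim H hij hne
  refine crossCheckMech_τ_add_le hij.symm (fun k hk => ?_) ?_
  · rw [Function.update_self, Function.update_of_ne hk]
    by_cases hkj : k = j
    · subst hkj
      exact (le_add_of_nonneg_right hH0.le).trans_eq hstep.symm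
    · exact (crossCheck_update_of_ne H hij hkj _ _ _).ge
  · rw [Function.update_self, Function.update_of_ne hij.symm]
    exact hstep.ge

lemma IsNE.report_self_eq (hI : 2 ≤ I) (hH0 : 0 < H) (hH : IsDecisiveStake w ν ζ H)
    (hσ : IsNE w (crossCheckMech ν ζ H) θ σ) {i : Fin I} {t : T i}
    (ht : ∀ k ≠ i, ∀ mk, 0 < σ k mk → mk.2 i = t) {mi : (crossCheckMech ν ζ H).M i}
    (hi : 0 < σ i mi) : mi.2 i = t := by
  by_contra hne
  have : Nontrivial (Fin I) := Fin.nontrivial_iff_two_le.2 hI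
  obtain ⟨k₀, hk₀⟩ := exists_ne i
  refine hσ.not_stake_gain hH (mi' := (mi.1, Function.update mi.2 i t)) hi fun m hm hmi => ?_
  subst hmi
  have hstep : ∀ k ≠ i, crossCheck H i k (Function.update (m i).2 i t) (m k) =
      crossCheck H i k (m i).2 (m k) + H := by
    intro k hk
    have hkt := ht k hk _ (hm k)
    rw [← hkt] at hne ⊢
    exact crossCheck_update_own H hk hne
  refine crossCheckMech_τ_add_le hk₀ (fun k hk => ?_) ?_
  · rw [Function.update_self, Function.update_of_ne hk]
    exact (le_add_of_nonneg_right hH0.le).trans_eq (hstep k hk).symm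
  · rw [Function.update_self, Function.update_of_ne hk₀]
    exact (hstep k₀ hk₀).ge

/-- If agent `j` always claims the true type, then everyone reports it. -/
lemma IsNE.report_eq_of_truthful (hI : 2 ≤ I) (hH0 : 0 < H) (hH : IsDecisiveStake w ν ζ H)
    (hσ : IsNE w (crossCheckMech ν ζ H) θ σ) {j : Fin I} {t : T j}
    (ht : ∀ mj, 0 < σ j mj → mj.1 = t) (i : Fin I) {mi : (crossCheckMech ν ζ H).M i}
    (hi : 0 < σ i mi) : mi.2 j = t := by
  by_cases hij : i = j
  · subst hij
    exact hσ.report_self_eq hI hH0 hH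
      (fun k hk mk hmk => hσ.report_eq_of_claim_eq hH0 hH hk ht hmk) hi
  · exact hσ.report_eq_of_claim_eq hH0 hH hij ht hi

variable {B : ℝ} {f : Θ → Outc A I}

lemma IsNE.not_truth_lt (hB : ∀ i a θ, |w i a θ| ≤ B) (hζ : IsChallengeScheme w f ν ζ)
    (hσ : IsNE w (crossCheckMech ν ζ H) θ σ) {m : ∀ j, (crossCheckMech ν ζ H).M j}
    (hm : ∀ j, 0 < σ j (m j)) (i : Fin I) :
    ¬ uT w i (ζ i (agreedState ν fun j => (m j).2) (m i).1) θ <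
      uT w i (ζ i (agreedState ν fun j => (m j).2) (ν i θ)) θ := by
  intro hlt
  refine (hσ.payoff_update_le (mi' := (ν i θ, (m i).2)) (fun n _ hni => ?_) hm rfl).not_gt
    ((payoff_le_payoff_truth hB hζ θ i m).2 hlt)
  rw [← hni]
  exact (payoff_le_payoff_truth hB hζ θ i n).1

/-- If a false claim of agent `j` is played, then all other agents agree with the accompanying
report, which is the type profile of some state. -/
lemma IsNE.report_eq_of_false_claim (hB : ∀ i a θ, |w i a θ| ≤ B)
    (hζ : IsChallengeScheme w f ν ζ) (hσ : IsNE w (crossCheckMech ν ζ H) θ σ) {j : Fin I}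
    {mj : (crossCheckMech ν ζ H).M j} (hj : 0 < σ j mj) (hne : mj.1 ≠ ν j θ) :
    (∃ θ', mj.2 = fun k => ν k θ') ∧
      ∀ i ≠ j, ∀ mi, 0 < σ i mi → mi.2 = mj.2 := by
  have hagree : ∀ m : ∀ k, (crossCheckMech ν ζ H).M k, (∀ k, 0 < σ k (m k)) → m j = mj →
      ∃ θ', ∀ k, (m k).2 = fun l => ν l θ' := by
    intro m hm hmj
    by_contra hno
    refine hσ.not_truth_lt hB hζ hm j ?_
    rw [agreedState_eq_none hno, hmj]
    exact hζ.none_lt j θ _ hne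
  obtain ⟨m, hm⟩ := hσ.1.exists_pos
  have hupd : ∀ (n : ∀ k, (crossCheckMech ν ζ H).M k), (∀ k, 0 < σ k (n k)) →
      ∀ i mi, 0 < σ i mi → ∀ k, 0 < σ k (Function.update n i mi k) := by
    intro n hn i mi hi k
    by_cases h : k = i
    · subst h; rwa [Function.update_self]
    · rw [Function.update_of_ne h]; exact hn k
  have hm' := hupd m hm j mj hj
  constructor
  · obtain ⟨θ', h⟩ := hagree _ hm' (Function.update_self ..)
    exact ⟨θ', by simpa using h j⟩
  · intro i hij mi hi
    obtain ⟨θ', h⟩ := hagree _ (hupd _ hm' i mi hi)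
      (by rw [Function.update_of_ne hij.symm, Function.update_self])
    have h1 := h i
    have h2 := h j
    rw [Function.update_self] at h1
    rw [Function.update_of_ne hij.symm, Function.update_self] at h2
    rw [h1, h2]

/-- In equilibrium all agents report the type profile of one and the same state. -/
lemma IsNE.exists_common_report (hI : 2 ≤ I) (hH0 : 0 < H) (hH : IsDecisiveStake w ν ζ H)
    (hB : ∀ i a θ, |w i a θ| ≤ B) (hζ : IsChallengeScheme w f ν ζ)
    (hσ : IsNE w (crossCheckMech ν ζ H) θ σ) :
    ∃ θ', ∀ i mi, 0 < σ i mi → mi.2 = fun k => ν k θ' := by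
  by_cases hall : ∀ j mj, 0 < σ j mj → mj.1 = ν j θ
  · exact ⟨θ, fun i mi hi => funext fun j =>
      hσ.report_eq_of_truthful hI hH0 hH (hall j) i hi⟩
  push Not at hall
  obtain ⟨j, mj, hj, hne⟩ := hall
  obtain ⟨⟨θ', hθ'⟩, hothers⟩ := hσ.report_eq_of_false_claim hB hζ hj hne
  refine ⟨θ', fun i mi hi => ?_⟩
  rw [← hθ']
  by_cases hij : i = j
  swap
  · exact hothers i hij mi hi
  subst hij
  by_cases hrest : ∀ k ≠ i, ∀ mk, 0 < σ k mk → mk.1 = ν k θ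
  · funext k
    by_cases hk : k = i
    · subst hk
      exact hσ.report_self_eq hI hH0 hH
        (fun l hl ml hml => congrFun (hothers l hl ml hml) k) hi
    · rw [hσ.report_eq_of_truthful hI hH0 hH (hrest k hk) i hi,
        hσ.report_eq_of_truthful hI hH0 hH (hrest k hk) i hj]
  · push Not at hrest
    obtain ⟨k, hk, mk, hmk, hkne⟩ := hrest
    have := (hσ.report_eq_of_false_claim hB hζ hmk hkne).2 i hk.symm
    rw [this mi hi, this mj hj]

lemma IsNE.outcome_eq (hI : 2 ≤ I) (hH0 : 0 < H) (hH : IsDecisiveStake w ν ζ H)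
    (hB : ∀ i a θ, |w i a θ| ≤ B) (hζ : IsChallengeScheme w f ν ζ)
    (hσ : IsNE w (crossCheckMech ν ζ H) θ σ) {m : ∀ j, (crossCheckMech ν ζ H).M j}
    (hm : ∀ j, 0 < σ j (m j)) :
    (crossCheckMech ν ζ H).g m = f θ ∧ ∀ i, (crossCheckMech ν ζ H).τ i m = 0 := by
  obtain ⟨θ₁, hθ₁⟩ := hσ.exists_common_report hI hH0 hH hB hζ
  obtain ⟨θ', hstate, hθ'⟩ := agreedState_of_forall (fun i => hθ₁ i (m i) (hm i))
  have hreport : ∀ i mi, 0 < σ i mi → mi.2 = fun k => ν k θ' := fun i mi hi => by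
    rw [hθ₁ i mi hi, ← hθ₁ i _ (hm i), hθ' i]
  have hfalse : ∀ j mj, 0 < σ j mj → mj.1 ≠ ν j θ →
      ζ j (some θ') mj.1 = f θ' ∧ ζ j (some θ') (ν j θ) = f θ' := by
    intro j mj hj hne
    refine (hζ.some_eq_or_lt j θ' θ _ hne).resolve_right ?_
    have hn : ∀ k, 0 < σ k (Function.update m j mj k) := by
      intro k
      by_cases h : k = j
      · subst h; rwa [Function.update_self]
      · rw [Function.update_of_ne h]; exact hm k
    have := hσ.not_truth_lt hB hζ hn j
    have hq : (fun k => (Function.update m j mj k).2) = fun k => (m k).2 :=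
      funext fun k => (hreport k _ (hn k)).trans (hreport k _ (hm k)).symm
    rwa [hq, hstate, Function.update_self] at this
  have htruth : ∀ j, ζ j (some θ') (ν j θ) = f θ' := by
    intro j
    by_cases h : ∀ mj, 0 < σ j mj → mj.1 = ν j θ
    · have := hσ.report_eq_of_truthful hI hH0 hH h j (hm j)
      rw [hreport j _ (hm j)] at this
      rw [← this]
      exact hζ.some_self j θ'
    · push Not at h
      obtain ⟨mj, hj, hne⟩ := h
      exact (hfalse j mj hj hne).2
  have hf : f θ' = f θ := hζ.eq_of_unchallenged θ' θ htruth
  constructor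
  · have hconst : (fun k => ζ k (agreedState ν fun i => (m i).2) (m k).1) = fun _ => f θ := by
      funext k
      rw [hstate, ← hf]
      by_cases h : (m k).1 = ν k θ
      · rw [h, htruth]
      · exact (hfalse k _ (hm k) h).1
    dsimp only
    rw [hconst, mix_const]
  · intro i
    dsimp only
    refine Finset.sum_eq_zero fun j _ => ?_
    rw [hreport i _ (hm i), ← hreport j _ (hm j), crossCheck_self]

lemma isPureNE_truth (hI : 2 ≤ I) (hH0 : 0 < H) (hH : IsDecisiveStake w ν ζ H)
    (hB : ∀ i a θ, |w i a θ| ≤ B) (hζ : IsChallengeScheme w f ν ζ) (θ : Θ) :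
    IsPureNE w (crossCheckMech ν ζ H) θ fun i => (ν i θ, fun k => ν k θ) := by
  rintro i ⟨t, q⟩
  set m : ∀ j, (crossCheckMech ν ζ H).M j := fun i => (ν i θ, fun k => ν k θ) with hm
  by_cases hq : q = fun k => ν k θ
  · have := (payoff_le_payoff_truth hB hζ θ i (Function.update m i (t, q))).1
    rw [hq]
    rwa [Function.update_self, Function.update_idem, hq,
      Function.update_eq_self_iff.2 (show m i = _ from rfl).symm] at this
  · refine (hH i θ _ _ ?_).le
    obtain ⟨j, hj⟩ := Function.ne_iff.1 hq
    obtain ⟨k, hk, hkj⟩ : ∃ k ≠ i, k = j ∨ i = j := by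
      have : Nontrivial (Fin I) := Fin.nontrivial_iff_two_le.2 hI
      by_cases hij : i = j
      · obtain ⟨k, hk⟩ := exists_ne i
        exact ⟨k, hk, Or.inr hij⟩
      · exact ⟨j, fun h => hij h.symm, Or.inl rfl⟩
    have hone : ∀ l, 0 ≤ H * (if q l = ν l θ then 0 else 1) := fun l => by
      split_ifs <;> linarith
    have hhonest : ∀ l, crossCheck H i l q (m l) = _ := fun l =>
      crossCheck_honest H i l (fun k => ν k θ) q
    refine crossCheckMech_τ_add_le hk (fun l hl => ?_) ?_
    · rw [Function.update_self, Function.update_of_ne hl, crossCheck_self H i l (m l),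
        hhonest]
      linarith [hone l, hone i]
    · rw [Function.update_self, Function.update_of_ne hk, crossCheck_self H i k (m k),
        hhonest]
      rcases hkj with rfl | rfl
      · have := hone i
        rw [if_neg hj]
        linarith
      · have := hone k
        rw [if_neg hj]
        linarith

end Mechanism

lemma MaskinMonotone.nashImplementable [Fintype Θ] [Nonempty A] (hI : 2 ≤ I)
    {w : Fin I → A → Θ → ℝ} {B : ℝ} (hB : ∀ i a θ, |w i a θ| ≤ B) {f : Θ → Outc A I}
    (hf : MaskinMonotone w f) : NashImplementable w f := by
  rcases isEmpty_or_nonempty Θ with hΘ | ⟨⟨θ₀⟩⟩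
  · exact ⟨⟨fun _ => Unit, inferInstance, inferInstance,
      fun _ => (PMF.pure (Classical.arbitrary A), 0), 0⟩, fun θ => (hΘ.false θ).elim⟩
  obtain ⟨T, hT, ν, ζ, hζ⟩ := hf.exists_isChallengeScheme hB
  have : Nonempty (Fin I) := ⟨⟨0, by lia⟩⟩
  have : ∀ j, Nonempty (T j) := fun j => ⟨ν j θ₀⟩
  obtain ⟨H, hH0, hH⟩ := exists_isDecisiveStake w ν ζ
  refine ⟨crossCheckMech ν ζ H, fun θ => ⟨⟨_, isPureNE_truth hI hH0 hH hB hζ θ⟩, ?_⟩⟩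
  rintro m ⟨σ, hσ, hpos⟩
  refine hσ.outcome_eq hI hH0 hH hB hζ fun j => lt_of_le_of_ne ((hσ.1 j).1 _) fun h => ?_
  exact hpos.ne' (Finset.prod_eq_zero (Finset.mem_univ j) h.symm)

/-- **Theorem 1** (Maskin meets Abreu and Matsushima): an SCF is implementable in
mixed-strategy Nash equilibria by a finite mechanism iff it is Maskin monotonic. -/
theorem scf_nashImplementable_iff_maskinMonotone
    [Fintype Θ] [Nonempty A] (hI : 2 ≤ I)
    (w : Fin I → A → Θ → ℝ) (B : ℝ) (hB : ∀ i a θ, |w i a θ| ≤ B)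
    (f : Θ → Outc A I) :
    NashImplementable w f ↔ MaskinMonotone w f := by
  exact ⟨NashImplementable.maskinMonotone, MaskinMonotone.nashImplementable hI hB⟩

end
end

section
/- Suppose there are at least three agents (I ≥ 3) and the SCF f satisfies Maskin monotonicity. Then f is implementable in pure-strategy Nash equilibria by a direct mechanism. -/
/-!
STATEMENT 4 (Proposition 1): Suppose there are at least three agents (I ≥ 3) and the SCF
f satisfies Maskin monotonicity. Then f is implementable in pure-strategy Nash equilibria
by a direct mechanism (each agent reports a state; a unanimous report θ yields f(θ) with
no transfers).
-/

open scoped BigOperators Classical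

noncomputable section

variable {A Θ : Type} {I : ℕ}

/-- Agent `i`'s payoff in the game induced at state `θ` by a direct mechanism `(g,τ)`
with message space `Θ` for each agent. -/
def payoffD (w : Fin I → A → Θ → ℝ) (g : (Fin I → Θ) → Outc A I)
    (τ : Fin I → (Fin I → Θ) → ℝ) (θ : Θ) (i : Fin I) (m : Fin I → Θ) : ℝ :=
  uT w i (g m) θ + τ i m

/-- Pure-strategy Nash equilibrium of the game induced by a direct mechanism `(g,τ)`. -/
def IsPureNED (w : Fin I → A → Θ → ℝ) (g : (Fin I → Θ) → Outc A I)
    (τ : Fin I → (Fin I → Θ) → ℝ) (θ : Θ) (m : Fin I → Θ) : Prop :=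
  ∀ (i : Fin I) (mi' : Θ),
    payoffD w g τ θ i (Function.update m i mi') ≤ payoffD w g τ θ i m

/-- All agents other than `i` send the same message in `m`. -/
def OthersAgree (m : Fin I → Θ) (i : Fin I) : Prop :=
  ∀ j k, j ≠ i → k ≠ i → m j = m k

theorem othersAgree_update_iff (m : Fin I → Θ) (i : Fin I) (a : Θ) :
    OthersAgree (Function.update m i a) i ↔ OthersAgree m i := by
  constructor
  · intro h j k hj hk
    simpa [hj, hk] using h j k hj hk
  · intro h j k hj hk
    simpa [hj, hk] using h j k hj hk

theorem Fin.exists_ne_ne (hI : 3 ≤ I) (i j : Fin I) : ∃ k, k ≠ i ∧ k ≠ j := by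
  have hcard : ({i, j} : Finset (Fin I)).card < (Finset.univ : Finset (Fin I)).card := by
    rw [Finset.card_univ, Fintype.card_fin]
    exact lt_of_le_of_lt Finset.card_le_two (by omega)
  obtain ⟨k, -, hk⟩ := Finset.exists_mem_notMem_of_card_lt_card hcard
  exact ⟨k, by simpa [not_or] using hk⟩

theorem eq_zero_of_forall_eq_add_one {n : ℕ} (m : Fin (n + 1) → Θ)
    (h : ∀ j, m j = m (j + 1)) (j : Fin (n + 1)) : m j = m 0 := by
  induction j using Fin.induction with
  | zero => rfl
  | succ k ih => rw [← ih, h k.castSucc, Fin.coeSucc_eq_succ]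

/-- In a non-unanimous profile of at least three agents, some agent disagrees with its successor
while the others disagree among themselves. -/
theorem exists_ne_add_one_not_othersAgree {n : ℕ} (m : Fin (n + 3) → Θ)
    (hm : ¬ ∃ a, m = fun _ => a) : ∃ j, m j ≠ m (j + 1) ∧ ¬ OthersAgree m j := by
  by_contra! h
  obtain ⟨j, hj⟩ : ∃ j, m j ≠ m (j + 1) := by
    by_contra! h'
    exact hm ⟨m 0, funext (eq_zero_of_forall_eq_add_one m h')⟩
  have h1 : j - 1 ≠ j := by simp [sub_eq_self]
  have h2 : j + 1 ≠ j := by simp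
  have h3 : j + 1 ≠ j - 1 := by
    intro he
    have h0 : (1 + 1 : Fin (n + 3)) = 0 := by
      have : j + (1 + 1) = j := by rw [← add_assoc, he, sub_add_cancel]
      simpa using this
    have := congrArg Fin.val h0
    simp [Fin.val_add, Nat.mod_eq_of_lt (show 2 < n + 3 by omega)] at this
  have hprev : m (j - 1) ≠ m (j - 1 + 1) := by
    rw [sub_add_cancel, h j hj (j - 1) (j + 1) h1 h2]
    exact hj.symm
  exact hj (h (j - 1) hprev j (j + 1) h1.symm h3)

/-- A Maskin-monotonic SCF admits a challenge scheme: outcomes `b i a c` that agent `i` does not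
prefer to `f a` at state `a`, one of which is a profitable challenge at `c` if `f a ≠ f c`. -/
theorem MaskinMonotone.exists_challenge {w : Fin I → A → Θ → ℝ} {f : Θ → Outc A I}
    (hf : MaskinMonotone w f) :
    ∃ b : Fin I → Θ → Θ → Outc A I,
      (∀ i a, b i a a = f a) ∧
      (∀ i a c, uT w i (b i a c) a ≤ uT w i (f a) a) ∧
      ∀ a c, f a ≠ f c → ∃ i, uT w i (f a) c < uT w i (b i a c) c := by
  have hb : ∀ i a c, ∃ x : Outc A I, (a = c → x = f a) ∧ uT w i x a ≤ uT w i (f a) a ∧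
      ((∃ y, uT w i y a ≤ uT w i (f a) a ∧ uT w i (f a) c < uT w i y c) →
        uT w i (f a) c < uT w i x c) := by
    intro i a c
    by_cases h : ∃ y, uT w i y a ≤ uT w i (f a) a ∧ uT w i (f a) c < uT w i y c
    · obtain ⟨y, hy⟩ := h
      refine ⟨y, ?_, hy.1, fun _ => hy.2⟩
      rintro rfl
      exact absurd hy.2 (not_lt.mpr hy.1)
    · exact ⟨f a, fun _ => rfl, le_rfl, fun h' => absurd h' h⟩
  choose b hb1 hb2 hb3 using hb
  refine ⟨b, fun i a => hb1 i a a rfl, hb2, fun a c hac => ?_⟩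
  obtain ⟨i, x, hx⟩ := hf a c hac
  exact ⟨i, hb3 i a c ⟨x, hx⟩⟩

/-- With at least three agents, outcomes can be prescribed at all unilateral deviations from
unanimous profiles. -/
theorem exists_outcome_update_const {X : Type*} (hI : 3 ≤ I) {f : Θ → X}
    {b : Fin I → Θ → Θ → X} (hb : ∀ i a, b i a a = f a) :
    ∃ g : (Fin I → Θ) → X, ∀ i a c, g (Function.update (fun _ => a) i c) = b i a c := by
  refine ⟨fun m => if h : ∃ p : Fin I × Θ, ∀ j ≠ p.1, m j = p.2 then
    b h.choose.1 h.choose.2 (m h.choose.1) else f (m ⟨0, by omega⟩), fun i a c => ?_⟩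
  have h : ∃ p : Fin I × Θ, ∀ j ≠ p.1, Function.update (fun _ => a) i c j = p.2 :=
    ⟨(i, a), fun j hj => by simp [hj]⟩
  simp only [dif_pos h]
  have hp := h.choose_spec
  generalize h.choose = p at hp ⊢
  obtain ⟨q, d⟩ := p
  obtain ⟨k, hki, hkq⟩ := Fin.exists_ne_ne hI i q
  have hd : a = d := by simpa [hki] using hp k hkq
  subst hd
  by_cases hqi : q = i
  · subst hqi
    simp
  · have hc : c = a := by simpa using hp i (Ne.symm hqi)
    simp [hc, hb]

/-- **Proposition 1**: with at least three agents, every Maskin-monotonic SCF is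
implementable in pure-strategy Nash equilibria by a direct mechanism. -/
theorem pure_implementable_by_direct_mechanism
    [Fintype Θ] [Nonempty A] (hI : 3 ≤ I)
    (w : Fin I → A → Θ → ℝ) (B : ℝ) (hB : ∀ i a θ, |w i a θ| ≤ B)
    (f : Θ → Outc A I) (hf : MaskinMonotone w f) :
    ∃ (g : (Fin I → Θ) → Outc A I) (τ : Fin I → (Fin I → Θ) → ℝ),
      -- a direct mechanism: a unanimous report leads to the socially desirable
      -- outcome with no transfers
      (∀ θ : Θ, g (fun _ => θ) = f θ ∧ ∀ i, τ i (fun _ => θ) = 0) ∧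
      -- implementation in pure-strategy Nash equilibria
      ∀ θ : Θ,
        (∃ m, IsPureNED w g τ θ m) ∧
        ∀ m, IsPureNED w g τ θ m → g m = f θ ∧ ∀ i, τ i m = 0 := by
  obtain ⟨n, rfl⟩ : ∃ n, I = n + 3 := ⟨I - 3, by omega⟩
  obtain ⟨b, hb1, hb2, hb3⟩ := hf.exists_challenge
  obtain ⟨g, hg⟩ := exists_outcome_update_const hI hb1
  have hgf : ∀ a, g (fun _ => a) = f a := fun a => by simpa [hb1] using hg 0 a a
  obtain ⟨K, hK⟩ : ∃ K, ∀ i m θ, |uT w i (g m) θ| ≤ K := by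
    obtain ⟨K, hK⟩ := (Set.finite_range fun p : Fin (n + 3) × (Fin (n + 3) → Θ) × Θ =>
      |uT w p.1 (g p.2.1) p.2.2|).bddAbove
    exact ⟨K, fun i m θ => hK ⟨(i, m, θ), rfl⟩⟩
  let τ : Fin (n + 3) → (Fin (n + 3) → Θ) → ℝ := fun i m =>
    if ¬ OthersAgree m i ∧ m i = m (i + 1) then 2 * K + 1 else 0
  have hτ0 : ∀ i m, OthersAgree m i → τ i m = 0 := fun i m h => by simp [τ, h]
  have hconst : ∀ (a : Θ) (i : Fin (n + 3)), OthersAgree (fun _ => a) i :=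
    fun _ _ _ _ _ _ => rfl
  have hdev : ∀ θ a i c, payoffD w g τ θ i (Function.update (fun _ => a) i c) =
      uT w i (b i a c) θ := fun θ a i c => by
    rw [payoffD, hg, hτ0 _ _ ((othersAgree_update_iff _ i c).2 (hconst a i)), add_zero]
  have hun : ∀ θ a i, payoffD w g τ θ i (fun _ => a) = uT w i (f a) θ := fun θ a i => by
    rw [payoffD, hgf, hτ0 _ _ (hconst a i), add_zero]
  refine ⟨g, τ, fun θ => ⟨hgf θ, fun i => hτ0 _ _ (hconst θ i)⟩, fun θ =>
    ⟨⟨fun _ => θ, fun i c => ?_⟩, fun m hm => ?_⟩⟩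
  · rw [hdev, hun]
    exact hb2 i θ c
  · by_cases hmu : ∃ a, m = fun _ => a
    · obtain ⟨a, rfl⟩ := hmu
      refine ⟨?_, fun i => hτ0 _ _ (hconst a i)⟩
      rw [hgf]
      by_contra hne
      obtain ⟨i, hi⟩ := hb3 a θ hne
      have hle := hm i θ
      rw [hdev, hun] at hle
      exact absurd hi (not_lt.mpr hle)
    · obtain ⟨j, hj, hoth⟩ := exists_ne_add_one_not_othersAgree m hmu
      have hle := hm j (m (j + 1))
      have hτ1 : τ j m = 0 := by simp [τ, hj]
      have hτ2 : τ j (Function.update m j (m (j + 1))) = 2 * K + 1 := by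
        simp [τ, othersAgree_update_iff, hoth]
      rw [payoffD, payoffD, hτ1, hτ2] at hle
      have h1 := abs_le.1 (hK j m θ)
      have h2 := abs_le.1 (hK j (Function.update m j (m (j + 1))) θ)
      linarith [h1.2, h2.1]

end
end

section
/- If the SCF f satisfies Maskin monotonicity, then there exists a finite mechanism 𝓜 such that for every complete-information prior μ, every (θ,s) in the support of μ, and every sequence of priors (ν^n) with d(ν^n,μ) → 0: (i) there exists a sequence of acts α_n induced by Bayesian Nash equilibria of Γ(𝓜,ν^n) with α_n(θ,s) → f(θ); and (ii) every sequence of acts α_n induced by Bayesian Nash equilibria of Γ(𝓜,ν^n) satisfies α_n(θ,s) → f(θ). In particular, every Maskin-monotonic SCF is N̄E-implementable. -/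
/-!
STATEMENT 6 (Proposition 3, robustness to information perturbations): If the SCF f
satisfies Maskin monotonicity, then there exists a finite mechanism 𝓜 such that for every
complete-information prior μ, every (θ,s) in the support of μ, and every sequence of
priors (ν^n) with d(ν^n,μ) → 0: (i) there exists a sequence of acts induced by Bayesian
Nash equilibria of Γ(𝓜,ν^n) converging at (θ,s) to f(θ); and (ii) every sequence of acts
induced by Bayesian Nash equilibria of Γ(𝓜,ν^n) converges at (θ,s) to f(θ).
-/

open scoped BigOperators Classical

noncomputable section

/-- Lotteries on a finite set `A`, modelled as the standard simplex. -/
abbrev Lot (A : Type) [Fintype A] : Type := ↥(stdSimplex ℝ A)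

/-- The outcome space `X = Δ(A) × ℝ^I`. -/
abbrev OutcS (A : Type) [Fintype A] (I : ℕ) : Type := Lot A × (Fin I → ℝ)

variable {A Θ : Type} {I : ℕ}

/-- Agent `i`'s quasilinear utility `ũ_i(x,θ) = v_i(ℓ,θ) + t_i`. -/
def uS [Fintype A] (w : Fin I → A → Θ → ℝ) (i : Fin I) (x : OutcS A I) (θ : Θ) : ℝ :=
  (∑ a, (x.1 : A → ℝ) a * w i a θ) + x.2 i

/-- Maskin monotonicity of an SCF `f : Θ → X`. -/
def MaskinMonotoneS [Fintype A] (w : Fin I → A → Θ → ℝ) (f : Θ → OutcS A I) : Prop :=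
  ∀ θ' θ : Θ, f θ' ≠ f θ →
    ∃ (i : Fin I) (x : OutcS A I),
      uS w i x θ' ≤ uS w i (f θ') θ' ∧ uS w i (f θ') θ < uS w i x θ

/-- A finite mechanism. -/
structure FinMechS (A : Type) [Fintype A] (I : ℕ) where
  M : Fin I → Type
  fintypeM : ∀ i, Fintype (M i)
  nonemptyM : ∀ i, Nonempty (M i)
  g : (∀ i, M i) → OutcS A I
  τ : Fin I → (∀ i, M i) → ℝ

attribute [instance] FinMechS.fintypeM FinMechS.nonemptyM

/-- Agent `i`'s ex-post payoff at state `θ`. -/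
def payoffS [Fintype A] (w : Fin I → A → Θ → ℝ) (𝓜 : FinMechS A I) (θ : Θ) (i : Fin I)
    (m : ∀ j, 𝓜.M j) : ℝ :=
  uS w i (𝓜.g m) θ + 𝓜.τ i m

/-- Signal profiles: each agent's signal space is `S_i = Θ`. -/
abbrev Sig (Θ : Type) (I : ℕ) : Type := Fin I → Θ

/-- The marginal probability that agent `i` observes signal `si`. -/
def margSig [Fintype Θ] (ν : Θ × Sig Θ I → ℝ) (i : Fin I) (si : Θ) : ℝ :=
  ∑ p : Θ × Sig Θ I, if p.2 i = si then ν p else 0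

/-- A prior: a probability distribution on `Θ × S` whose marginal on each `S_i` assigns
positive probability to every signal. -/
def IsPrior [Fintype Θ] (ν : Θ × Sig Θ I → ℝ) : Prop :=
  (∀ p, 0 ≤ ν p) ∧ ((∑ p, ν p) = 1) ∧ ∀ i si, 0 < margSig ν i si

/-- A complete-information prior: `μ(θ,s) = 0` whenever `s ≠ s^θ`. -/
def IsCompleteInfoPrior [Fintype Θ] (μ : Θ × Sig Θ I → ℝ) : Prop :=
  IsPrior μ ∧ ∀ (θ : Θ) (s : Sig Θ I), s ≠ (fun _ => θ) → μ (θ, s) = 0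

/-- The uniform distance between two priors. -/
def priorDist [Fintype Θ] (μ ν : Θ × Sig Θ I → ℝ) : ℝ :=
  ⨆ p : Θ × Sig Θ I, |μ p - ν p|

/-- A (behavioural) strategy profile of the incomplete-information game `Γ(𝓜,ν)`. -/
def IsBayesStrategy [Fintype Θ] [Fintype A] (𝓜 : FinMechS A I)
    (σ : ∀ i, Θ → 𝓜.M i → ℝ) : Prop :=
  ∀ i si, (∀ mi, 0 ≤ σ i si mi) ∧ (∑ mi, σ i si mi) = 1

/-- Agent `i`'s conditional expected payoff from message `mi` given signal `si`, against
the opponents' strategies. -/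
def interimPay [Fintype Θ] [Fintype A] (w : Fin I → A → Θ → ℝ) (𝓜 : FinMechS A I)
    (ν : Θ × Sig Θ I → ℝ) (σ : ∀ i, Θ → 𝓜.M i → ℝ) (i : Fin I) (si : Θ) (mi : 𝓜.M i) : ℝ :=
  (∑ p : Θ × Sig Θ I, ∑ m : ∀ j, 𝓜.M j,
      (if p.2 i = si then ν p else 0) *
        ((∏ j ∈ Finset.univ.erase i, σ j (p.2 j) (m j)) *
          (if m i = mi then payoffS w 𝓜 p.1 i m else 0))) / margSig ν i si

/-- Bayesian Nash equilibrium of `Γ(𝓜,ν)`. -/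
def IsBNE [Fintype Θ] [Fintype A] (w : Fin I → A → Θ → ℝ) (𝓜 : FinMechS A I)
    (ν : Θ × Sig Θ I → ℝ) (σ : ∀ i, Θ → 𝓜.M i → ℝ) : Prop :=
  IsBayesStrategy 𝓜 σ ∧
    ∀ (i : Fin I) (si : Θ) (mi : 𝓜.M i), 0 < σ i si mi → ∀ mi' : 𝓜.M i,
      interimPay w 𝓜 ν σ i si mi' ≤ interimPay w 𝓜 ν σ i si mi

/-- The act induced by a strategy profile: the expected outcome (compound lottery and
expected transfers, through `(g,(τ_i))`) at signal profile `s`, represented in the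
ambient space `(A → ℝ) × ℝ^I`. -/
def act [Fintype A] (𝓜 : FinMechS A I) (σ : ∀ i, Θ → 𝓜.M i → ℝ) (s : Sig Θ I) :
    (A → ℝ) × (Fin I → ℝ) :=
  (fun a => ∑ m : ∀ j, 𝓜.M j, (∏ j, σ j (s j) (m j)) * ((𝓜.g m).1 : A → ℝ) a,
   fun i => ∑ m : ∀ j, 𝓜.M j, (∏ j, σ j (s j) (m j)) * ((𝓜.g m).2 i + 𝓜.τ i m))

/-- The ambient-space representation of an outcome. -/
def amb [Fintype A] (x : OutcS A I) : (A → ℝ) × (Fin I → ℝ) := ((x.1 : A → ℝ), x.2)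

/-! ### A combinatorial lemma of Scarf -/

section Scarf

theorem card_filter_image_erase_eq {α β : Type*} (S : Finset α) (h : α → β)
    (hS : (S.image h).card + 1 = S.card) :
    (S.filter fun a => (S.erase a).image h = S.image h).card = 2 := by
  obtain ⟨a, ha, b, hb, hab, hf⟩ :=
    Finset.exists_ne_map_eq_of_card_lt_of_maps_to (s := S) (t := S.image h) (by omega)
      (fun x hx => Finset.mem_image_of_mem h hx)
  have key : ∀ x ∈ S, ((S.erase x).image h = S.image h ↔ ∃ y ∈ S, y ≠ x ∧ h y = h x) := by
    intro x hx
    constructor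
    · intro e
      have : h x ∈ (S.erase x).image h := e ▸ Finset.mem_image_of_mem h hx
      obtain ⟨y, hy, hyx⟩ := Finset.mem_image.1 this
      exact ⟨y, Finset.mem_of_mem_erase hy, Finset.ne_of_mem_erase hy, hyx⟩
    · rintro ⟨y, hy, hyx, e⟩
      apply Finset.Subset.antisymm (Finset.image_subset_image (Finset.erase_subset _ _))
      intro z hz
      obtain ⟨u, hu, rfl⟩ := Finset.mem_image.1 hz
      by_cases hux : u = x
      · subst hux
        exact Finset.mem_image.2 ⟨y, Finset.mem_erase.2 ⟨hyx, hy⟩, e⟩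
      · exact Finset.mem_image_of_mem h (Finset.mem_erase.2 ⟨hux, hu⟩)
  have hinj : Set.InjOn h (S.erase a : Finset α) := by
    apply Finset.injOn_of_card_image_eq
    rw [(key a ha).2 ⟨b, hb, hab.symm, hf.symm⟩, Finset.card_erase_of_mem ha]
    omega
  have : (S.filter fun a => (S.erase a).image h = S.image h) = {a, b} := by
    ext x
    simp only [Finset.mem_filter, Finset.mem_insert, Finset.mem_singleton]
    constructor
    · rintro ⟨hx, e⟩
      obtain ⟨y, hy, hyx, e⟩ := (key x hx).1 e
      by_contra! hne
      by_cases hya : y = a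
      · subst hya
        exact hne.2 (hinj (by simp [hx, hne.1]) (by simp [hb, hab.symm]) (e.symm.trans hf))
      · exact hyx (hinj (by simp [hy, hya]) (by simp [hx, hne.1]) e)
    · rintro (rfl | rfl)
      · exact ⟨ha, (key _ ha).2 ⟨b, hb, hab.symm, hf.symm⟩⟩
      · exact ⟨hb, (key _ hb).2 ⟨a, ha, hab, hf⟩⟩
  rw [this, Finset.card_pair hab]

variable {ι V : Type*} [Fintype ι] [Fintype V]

/-- A set of points is dominant for the rankings `r i` if every point is weakly below the whole
set in some ranking. -/
def ScarfDominant (r : ι → V → ℕ) (σ : Finset V) : Prop :=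
  ∀ y, ∃ i, ∀ x ∈ σ, r i y ≤ r i x

/-- The dominant sets with as many elements as there are rankings. -/
def scarfRooms (r : ι → V → ℕ) : Finset (Finset V) :=
  Finset.univ.filter fun σ => ScarfDominant r σ ∧ σ.card = Fintype.card ι

theorem card_rooms_containing_eq_two (r : ι → V → ℕ) (hr : ∀ i, Function.Injective (r i))
    (τ : Finset V) (hτ : ScarfDominant r τ) (hcard : τ.card + 1 = Fintype.card ι)
    (μ : ι → V) (hμ : ∀ i, μ i ∈ τ) (hmin : ∀ i, ∀ x ∈ τ, r i (μ i) ≤ r i x)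
    (hY : ∀ i, ∃ y, ∀ k, k ≠ i → r k (μ k) < r k y) :
    ((scarfRooms r).filter fun σ => τ ⊆ σ).card = 2 := by
  have himg : Finset.univ.image μ = τ := by
    apply Finset.Subset.antisymm
    · intro x hx
      obtain ⟨i, -, rfl⟩ := Finset.mem_image.1 hx
      exact hμ i
    · intro x hx
      obtain ⟨i, hi⟩ := hτ x
      exact Finset.mem_image.2
        ⟨i, Finset.mem_univ _, hr i (le_antisymm (hmin i x hx) (hi _ (hμ i)))⟩
  have h2 := card_filter_image_erase_eq (Finset.univ : Finset ι) μ
    (by rw [himg, hcard, Finset.card_univ])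
  rw [himg] at h2
  have hmax : ∀ i, ∃ x, (∀ k, k ≠ i → r k (μ k) < r k x) ∧
      ∀ y, (∀ k, k ≠ i → r k (μ k) < r k y) → r i y ≤ r i x := by
    intro i
    obtain ⟨y, hy⟩ := hY i
    obtain ⟨x, hx, hx'⟩ := Finset.exists_max_image
      (Finset.univ.filter fun y => ∀ k, k ≠ i → r k (μ k) < r k y) (r i) ⟨y, by simpa using hy⟩
    exact ⟨x, by simpa using hx, fun y hy => hx' y (by simpa using hy)⟩
  choose X hX hXmax using hmax
  have hXle : ∀ i, r i (X i) ≤ r i (μ i) := by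
    intro i
    obtain ⟨m, hm⟩ := hτ (X i)
    by_cases hmi : m = i
    · subst hmi
      exact hm _ (hμ m)
    · exact absurd (hm _ (hμ m)) (not_le.2 (hX i m hmi))
  rw [← h2]
  symm
  have hnot : ∀ i, (Finset.univ.erase i).image μ = τ → X i ∉ τ := by
    intro i hi hmem
    rw [← hi] at hmem
    obtain ⟨k, hk, hkX⟩ := Finset.mem_image.1 hmem
    have := hX i k (Finset.ne_of_mem_erase hk)
    rw [hkX] at this
    exact lt_irrefl _ this
  refine Finset.card_bij (fun i _ => insert (X i) τ) ?_ ?_ ?_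
  · intro i hi
    have hi := (Finset.mem_filter.1 hi).2
    simp only [scarfRooms, Finset.mem_filter, Finset.mem_univ, true_and]
    refine ⟨⟨?_, by rw [Finset.card_insert_of_notMem (hnot i hi), hcard]⟩,
      Finset.subset_insert _ _⟩
    intro y
    by_cases hy : ∀ k, k ≠ i → r k (μ k) < r k y
    · refine ⟨i, fun x hx => ?_⟩
      rcases Finset.mem_insert.1 hx with rfl | hx
      · exact hXmax i y hy
      · exact (hXmax i y hy).trans ((hXle i).trans (hmin i x hx))
    · push Not at hy
      obtain ⟨k, hki, hk⟩ := hy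
      refine ⟨k, fun x hx => ?_⟩
      rcases Finset.mem_insert.1 hx with rfl | hx
      · exact hk.trans (hX i k hki).le
      · exact hk.trans (hmin k x hx)
  · intro i hi j hj hij
    have hi := (Finset.mem_filter.1 hi).2
    have hj := (Finset.mem_filter.1 hj).2
    have hXX : X i = X j := by
      have : X i ∈ insert (X j) τ := hij ▸ Finset.mem_insert_self _ _
      exact (Finset.mem_insert.1 this).resolve_right (hnot i hi)
    by_contra hne
    have h1 := hX j i hne
    rw [← hXX] at h1
    exact absurd (hXle i) (not_le.2 h1)
  · intro σ hσ
    simp only [scarfRooms, Finset.mem_filter, Finset.mem_univ, true_and] at hσ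
    obtain ⟨⟨hdom, hσc⟩, hsub⟩ := hσ
    obtain ⟨x, hx, rfl⟩ : ∃ x, x ∉ τ ∧ insert x τ = σ := by
      have : (σ \ τ).card = 1 := by rw [Finset.card_sdiff_of_subset hsub]; omega
      obtain ⟨x, hx⟩ := Finset.card_eq_one.1 this
      refine ⟨x, fun h => ?_, ?_⟩
      · have : x ∈ σ \ τ := hx ▸ Finset.mem_singleton_self x
        exact (Finset.mem_sdiff.1 this).2 h
      · rw [Finset.insert_eq, ← hx, Finset.sdiff_union_of_subset hsub]
    obtain ⟨i, hi⟩ := hdom x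
    have hidx : ∀ z ∈ τ, ∃ k, k ≠ i ∧ μ k = z ∧ r k z < r k x := by
      intro z hz
      obtain ⟨k, hk⟩ := hdom z
      have hzx : z ≠ x := fun h => hx (h ▸ hz)
      refine ⟨k, ?_, hr k (le_antisymm (hmin k z hz) (hk _ (Finset.mem_insert_of_mem (hμ k)))), ?_⟩
      · rintro rfl
        exact hzx (hr k (le_antisymm (hk x (Finset.mem_insert_self _ _))
          (hi z (Finset.mem_insert_of_mem hz))))
      · exact lt_of_le_of_ne (hk x (Finset.mem_insert_self _ _)) (fun h => hzx (hr k h))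
    have hP : (Finset.univ.erase i).image μ = τ := by
      apply Finset.Subset.antisymm
      · intro z hz
        obtain ⟨k, -, rfl⟩ := Finset.mem_image.1 hz
        exact hμ k
      · intro z hz
        obtain ⟨k, hki, hk, -⟩ := hidx z hz
        exact Finset.mem_image.2 ⟨k, by simp [hki], hk⟩
    have hinj : Set.InjOn μ (Finset.univ.erase i : Finset ι) := by
      apply Finset.injOn_of_card_image_eq
      rw [hP, Finset.card_erase_of_mem (Finset.mem_univ _), Finset.card_univ]
      omega
    have hxY : ∀ k, k ≠ i → r k (μ k) < r k x := by
      intro k hk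
      obtain ⟨k', hk', hkk, hlt⟩ := hidx (μ k) (hμ k)
      have : k' = k := hinj (by simp [hk']) (by simp [hk]) hkk
      rwa [this] at hlt
    refine ⟨i, by simp [hP], ?_⟩
    obtain ⟨m, hm⟩ := hdom (X i)
    have hmi : m = i := by
      by_contra hmi
      exact absurd (hm _ (Finset.mem_insert_of_mem (hμ m))) (not_le.2 (hX i m hmi))
    subst hmi
    rw [hr m (le_antisymm (hm x (Finset.mem_insert_self _ _)) (hXmax m x hxY))]

theorem card_doors_even_of_not_colorful {σ : Finset V} (c : V → ι) (i₀ : ι)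
    (hσ : σ.card = Fintype.card ι) (hc : σ.image c ≠ Finset.univ) :
    Even ((Finset.univ.filter fun τ : Finset V => τ.card + 1 = Fintype.card ι ∧
      τ.image c = Finset.univ.erase i₀ ∧ τ ⊆ σ).card) := by
  have hbij : (Finset.univ.filter fun τ : Finset V => τ.card + 1 = Fintype.card ι ∧
      τ.image c = Finset.univ.erase i₀ ∧ τ ⊆ σ).card =
      (σ.filter fun x => (σ.erase x).image c = Finset.univ.erase i₀).card := by
    symm
    refine Finset.card_bij (fun x _ => σ.erase x) ?_ ?_ ?_
    · intro x hx
      obtain ⟨hx, h⟩ := Finset.mem_filter.1 hx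
      simp only [Finset.mem_filter, Finset.mem_univ, true_and]
      exact ⟨by rw [Finset.card_erase_add_one hx, hσ], h, Finset.erase_subset _ _⟩
    · intro x hx y hy hxy
      exact Finset.erase_injOn σ (Finset.mem_filter.1 hx).1 (Finset.mem_filter.1 hy).1 hxy
    · intro τ hτ
      simp only [Finset.mem_filter, Finset.mem_univ, true_and] at hτ
      obtain ⟨h1, h2, h3⟩ := hτ
      have : (σ \ τ).card = 1 := by rw [Finset.card_sdiff_of_subset h3]; omega
      obtain ⟨x, hx⟩ := Finset.card_eq_one.1 this
      have e : σ.erase x = τ := by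
        rw [Finset.erase_eq, ← hx, Finset.sdiff_sdiff_eq_self h3]
      have hxs : x ∈ σ \ τ := hx ▸ Finset.mem_singleton_self x
      exact ⟨x, Finset.mem_filter.2 ⟨(Finset.mem_sdiff.1 hxs).1, by rw [e, h2]⟩, e⟩
  rw [hbij]
  by_cases hne : ∃ x ∈ σ, (σ.erase x).image c = Finset.univ.erase i₀
  · obtain ⟨x, hx, hxe⟩ := hne
    have himg : σ.image c = Finset.univ.erase i₀ := by
      have h1 : σ.image c = insert (c x) (Finset.univ.erase i₀) := by
        rw [← hxe, ← Finset.image_insert, Finset.insert_erase hx]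
      have h2 : c x ≠ i₀ := by
        intro h
        apply hc
        rw [h1, h, Finset.insert_erase (Finset.mem_univ _)]
      rw [h1, Finset.insert_eq_of_mem (by simp [h2])]
    have := card_filter_image_erase_eq σ c
      (by rw [himg, hσ, Finset.card_erase_add_one (Finset.mem_univ _), Finset.card_univ])
    rw [himg] at this
    rw [this]
    exact even_two
  · push Not at hne
    rw [Finset.filter_false_of_mem hne]
    simp

/-- Scarf's lemma: if the points `s i` are bottom in the `i`-th ranking and on top of all other
points in the remaining rankings, then every colouring giving `s i` the colour `i` admits a
dominant set using each colour exactly once. -/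
theorem exists_colorful_room [Nonempty ι] (r : ι → V → ℕ) (hr : ∀ i, Function.Injective (r i))
    (s : ι → V) (hs : Function.Injective s)
    (hbot : ∀ i v, r i (s i) ≤ r i v)
    (htop : ∀ i j v, j ≠ i → v ∉ Set.range s → r i v < r i (s j))
    (c : V → ι) (hc : ∀ i, c (s i) = i) :
    ∃ σ, ScarfDominant r σ ∧ σ.image c = Finset.univ := by
  by_contra! hno
  obtain ⟨i₀⟩ := ‹Nonempty ι›
  set D : Finset (Finset V) := Finset.univ.filter fun τ => τ.card + 1 = Fintype.card ι ∧
    τ.image c = Finset.univ.erase i₀ with hD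
  have hcount := Finset.sum_card_bipartiteAbove_eq_sum_card_bipartiteBelow
    (s := D) (t := scarfRooms r) (fun τ σ => τ ⊆ σ)
  have heven : Even (∑ σ ∈ scarfRooms r, (D.bipartiteBelow (fun τ σ => τ ⊆ σ) σ).card) := by
    apply Finset.even_sum
    intro σ hσ
    simp only [scarfRooms, Finset.mem_filter, Finset.mem_univ, true_and] at hσ
    have := card_doors_even_of_not_colorful c i₀ hσ.2 (hno σ hσ.1)
    have e : D.bipartiteBelow (fun τ σ => τ ⊆ σ) σ = Finset.univ.filter fun τ : Finset V =>
        τ.card + 1 = Fintype.card ι ∧ τ.image c = Finset.univ.erase i₀ ∧ τ ⊆ σ := by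
      ext τ
      simp [hD, Finset.bipartiteBelow, and_assoc]
    rwa [e]
  set τ₀ : Finset V := (Finset.univ.erase i₀).image s with hτ₀
  have hτ₀D : τ₀ ∈ D := by
    simp only [hD, Finset.mem_filter, Finset.mem_univ, true_and]
    constructor
    · rw [hτ₀, Finset.card_image_of_injective _ hs, Finset.card_erase_add_one (Finset.mem_univ _),
        Finset.card_univ]
    · rw [hτ₀, Finset.image_image]
      have : c ∘ s = id := funext hc
      rw [this, Finset.image_id]
  rw [← hcount, ← Finset.add_sum_erase _ _ hτ₀D] at heven
  have hrest : Even (∑ τ ∈ D.erase τ₀,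
      ((scarfRooms r).bipartiteAbove (fun τ σ => τ ⊆ σ) τ).card) := by
    apply Finset.even_sum
    intro τ hτ
    obtain ⟨hne, hτ⟩ := Finset.mem_erase.1 hτ
    simp only [hD, Finset.mem_filter, Finset.mem_univ, true_and] at hτ
    obtain ⟨hτc, hτi⟩ := hτ
    by_cases hdom : ScarfDominant r τ
    · have hnonempty : τ.Nonempty := by
        rw [Finset.nonempty_iff_ne_empty]
        rintro rfl
        apply hne
        rw [hτ₀, ← hτi]
        simp
      choose μ hμ hmin using fun i => Finset.exists_min_image τ (r i) hnonempty
      have hμs : ∀ k l, μ k = s l → l = k := by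
        intro k l hkl
        by_contra hlk
        apply hne
        have hsub : τ ⊆ (Finset.univ.erase k).image s := by
          intro x hx
          have hx1 := hmin k x hx
          by_cases hxr : x ∈ Set.range s
          · obtain ⟨m, rfl⟩ := hxr
            refine Finset.mem_image_of_mem _ ?_
            refine Finset.mem_erase.2 ⟨?_, Finset.mem_univ _⟩
            rintro rfl
            have := hr m (le_antisymm hx1 (hbot m _))
            exact hlk (hs (hkl.symm.trans this))
          · have := htop k l x hlk hxr
            rw [hkl] at hx1
            omega
        have heq : τ = (Finset.univ.erase k).image s := by
          apply Finset.eq_of_subset_of_card_le hsub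
          rw [Finset.card_image_of_injective _ hs, Finset.card_erase_of_mem (Finset.mem_univ _),
            Finset.card_univ]
          omega
        have hki : k = i₀ := by
          by_contra hki
          have : c (s i₀) ∈ τ.image c := by
            rw [heq]
            exact Finset.mem_image_of_mem _
              (Finset.mem_image_of_mem _ (by simp [Ne.symm hki]))
          rw [hτi, hc] at this
          simp at this
        rw [heq, hki, hτ₀]
      have h2 := card_rooms_containing_eq_two r hr τ hdom hτc μ hμ hmin (by
        intro i
        refine ⟨s i, fun k hk => ?_⟩
        by_cases hk' : μ k ∈ Set.range s
        · obtain ⟨l, hl⟩ := hk'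
          obtain rfl := hμs k l hl.symm
          rw [← hl]
          exact lt_of_le_of_ne (hbot l _) (fun h => hk (hs (hr l h)))
        · exact htop k i _ hk.symm hk')
      unfold Finset.bipartiteAbove
      rw [h2]
      exact even_two
    · have : (scarfRooms r).bipartiteAbove (fun τ σ => τ ⊆ σ) τ = ∅ := by
        rw [Finset.eq_empty_iff_forall_notMem]
        intro σ hσ
        simp only [Finset.bipartiteAbove, scarfRooms, Finset.mem_filter, Finset.mem_univ,
          true_and] at hσ
        apply hdom
        intro y
        obtain ⟨i, hi⟩ := hσ.1.1 y
        exact ⟨i, fun x hx => hi x (hσ.2 hx)⟩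
      rw [this]
      simp
  have hone : ((scarfRooms r).bipartiteAbove (fun τ σ => τ ⊆ σ) τ₀).card = 1 := by
    have hsi₀ : s i₀ ∉ τ₀ := by
      simp [hτ₀, hs.eq_iff]
    obtain ⟨x, hx, hxmax⟩ := Finset.exists_max_image
      (Finset.univ.filter fun v => v ∉ τ₀) (r i₀) ⟨s i₀, by simpa using hsi₀⟩
    replace hx : x ∉ τ₀ := by simpa using hx
    replace hxmax : ∀ y, y ∉ τ₀ → r i₀ y ≤ r i₀ x := fun y hy => hxmax y (by simpa using hy)
    have hτ₀card : τ₀.card + 1 = Fintype.card ι := by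
      simp only [hD, Finset.mem_filter] at hτ₀D
      exact hτ₀D.2.1
    have hmem : ∀ y, y ∈ τ₀ ↔ ∃ m, m ≠ i₀ ∧ s m = y := by
      intro y
      simp [hτ₀]
    rw [Finset.card_eq_one]
    refine ⟨insert x τ₀, ?_⟩
    ext σ
    simp only [Finset.bipartiteAbove, scarfRooms, Finset.mem_filter, Finset.mem_univ, true_and,
      Finset.mem_singleton]
    constructor
    · rintro ⟨⟨hdom, hσc⟩, hsub⟩
      have hc1 : (σ \ τ₀).card = 1 := by rw [Finset.card_sdiff_of_subset hsub]; omega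
      obtain ⟨z, hz⟩ := Finset.card_eq_one.1 hc1
      have hzs : z ∈ σ \ τ₀ := hz ▸ Finset.mem_singleton_self z
      obtain ⟨hzσ, hzτ⟩ := Finset.mem_sdiff.1 hzs
      obtain ⟨i, hi⟩ := hdom x
      have hii : i = i₀ := by
        by_contra hii
        have h1 := hi (s i) (hsub ((hmem _).2 ⟨i, hii, rfl⟩))
        have h2 := hr i (le_antisymm h1 (hbot i x))
        exact hx ((hmem _).2 ⟨i, hii, h2.symm⟩)
      subst hii
      have hxz : x = z := hr i (le_antisymm (hi z hzσ) (hxmax z hzτ))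
      rw [hxz, Finset.insert_eq, ← hz, Finset.sdiff_union_of_subset hsub]
    · rintro rfl
      refine ⟨⟨?_, by rw [Finset.card_insert_of_notMem hx, hτ₀card]⟩, Finset.subset_insert _ _⟩
      intro y
      by_cases hy : y ∈ τ₀
      · obtain ⟨m, -, rfl⟩ := (hmem y).1 hy
        exact ⟨m, fun v _ => hbot m v⟩
      · refine ⟨i₀, fun v hv => ?_⟩
        rcases Finset.mem_insert.1 hv with rfl | hv
        · exact hxmax y hy
        · obtain ⟨m, hm, rfl⟩ := (hmem v).1 hv
          by_cases hyr : y ∈ Set.range s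
          · obtain ⟨l, rfl⟩ := hyr
            have : l = i₀ := by
              by_contra hl
              exact hy ((hmem _).2 ⟨l, hl, rfl⟩)
            rw [this]
            exact hbot i₀ _
          · exact (htop i₀ m y hm hyr).le
  rw [hone, Nat.even_add] at heven
  exact absurd (heven.2 hrest) (by decide)

end Scarf

section Covering

variable {ι : Type*} [Fintype ι]

/-- Scarf's lemma for points carrying a natural height in each coordinate. -/
theorem exists_dominant_colored {T : Type*} [Fintype T] [Nonempty T] [Nonempty ι]
    (h : ι → T → ℕ) (c : T → ι) :
    ∃ (σ : Finset T) (C : Finset ι), σ.Nonempty ∧ σ.image c = C ∧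
      ∀ y, ∃ i ∈ C, ∀ x ∈ σ, h i y ≤ h i x := by
  set N := Fintype.card T
  set e := Fintype.equivFin T
  set d := Fintype.equivFin ι
  obtain ⟨B, hB⟩ : ∃ B, ∀ i x, 1 + (h i x * N + e x) < B := by
    obtain ⟨B, hB⟩ := Finite.exists_le (fun p : ι × T => 1 + (h p.1 p.2 * N + e p.2))
    exact ⟨B + 1, fun i x => Nat.lt_succ_of_le (hB (i, x))⟩
  set r : ι → T ⊕ ι → ℕ := fun i v =>
    Sum.elim (fun x => 1 + (h i x * N + e x)) (fun j => if j = i then 0 else B + 1 + d j) v with hr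
  have hdiv : ∀ i x y, h i x * N + e x ≤ h i y * N + e y → h i x ≤ h i y := by
    intro i x y hxy
    by_contra! hlt
    have h1 : (h i y + 1) * N ≤ h i x * N := Nat.mul_le_mul_right _ hlt
    have h2 := (e y).isLt
    rw [add_mul, one_mul] at h1
    omega
  have hinj : ∀ i, Function.Injective (r i) := by
    rintro i (x | j) (y | k) hxy
    · simp only [hr, Sum.elim_inl] at hxy
      have h1 := le_antisymm (hdiv i x y (by omega)) (hdiv i y x (by omega))
      rw [h1] at hxy
      have : e x = e y := Fin.ext (by omega)
      rw [e.injective this]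
    · exfalso
      have := hB i x
      simp only [hr, Sum.elim_inl, Sum.elim_inr] at hxy
      split_ifs at hxy <;> omega
    · exfalso
      have := hB i y
      simp only [hr, Sum.elim_inl, Sum.elim_inr] at hxy
      split_ifs at hxy <;> omega
    · simp only [hr, Sum.elim_inr] at hxy
      split_ifs at hxy with h1 h2 h2
      · rw [h1, h2]
      · omega
      · omega
      · have : d j = d k := Fin.ext (by omega)
        rw [d.injective this]
  obtain ⟨σ, hdom, hcol⟩ := exists_colorful_room r hinj Sum.inr Sum.inr_injective
    (by intro i v; simp [hr])
    (by
      rintro i j (x | k) hji hv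
      · have := hB i x
        simp only [hr, Sum.elim_inl, Sum.elim_inr, if_neg hji]
        omega
      · exact absurd ⟨k, rfl⟩ hv)
    (Sum.elim c id) (by simp)
  set σ' : Finset T := Finset.univ.filter fun x => Sum.inl x ∈ σ with hσ'
  have key : ∀ y, ∃ i ∈ σ'.image c, ∀ x ∈ σ', h i y ≤ h i x := by
    intro y
    obtain ⟨i, hi⟩ := hdom (Sum.inl y)
    refine ⟨i, ?_, fun x hx => ?_⟩
    · have : i ∈ σ.image (Sum.elim c id) := hcol ▸ Finset.mem_univ i
      obtain ⟨x | j, hx, hxi⟩ := Finset.mem_image.1 this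
      · exact Finset.mem_image.2 ⟨x, by simpa [hσ'] using hx, hxi⟩
      · have h1 := hi _ hx
        have h2 : j = i := hxi
        simp [hr, h2] at h1
    · have h1 := hi (Sum.inl x) (by simpa [hσ'] using hx)
      simp only [hr, Sum.elim_inl] at h1
      exact hdiv i y x (by omega)
  obtain ⟨y⟩ := ‹Nonempty T›
  obtain ⟨i, hi, -⟩ := key y
  exact ⟨σ', σ'.image c, Finset.image_nonempty.1 ⟨i, hi⟩, rfl, key⟩

/-- The points of the standard simplex with denominator `N`. -/
theorem exists_clustered_grid_points [Nonempty ι] (c : (ι → ℝ) → ι) {N : ℕ} (hN : 0 < N) :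
    ∃ z : ι → ι → ℝ, (∀ i, z i ∈ stdSimplex ℝ ι) ∧
      (∀ i j k, |z i k - z j k| ≤ Fintype.card ι / N) ∧
      ∀ i, c (z i) = i ∨ z i i ≤ Fintype.card ι / N := by
  set T := {x : ι → ℕ // ∑ i, x i = N}
  have hle : ∀ x : T, ∀ i, x.1 i ≤ N := fun x i =>
    (Finset.single_le_sum (fun _ _ => Nat.zero_le _) (Finset.mem_univ i)).trans x.2.le
  have : Finite T := by
    apply Finite.of_injective (fun (x : T) (i : ι) => (⟨x.1 i, Nat.lt_succ_of_le (hle x i)⟩ :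
      Fin (N + 1)))
    intro x y hxy
    ext i
    exact congrArg Fin.val (congrFun hxy i)
  have : Fintype T := Fintype.ofFinite T
  obtain ⟨i₀⟩ := ‹Nonempty ι›
  have : Nonempty T := ⟨⟨Pi.single i₀ N, by simp⟩⟩
  have : Nonempty ι := ⟨i₀⟩
  set q : T → ι → ℝ := fun x i => (x.1 i : ℝ) / N with hq
  have hN' : (0 : ℝ) < N := by exact_mod_cast hN
  obtain ⟨σ, C, hσ, hC, hdom⟩ := exists_dominant_colored (fun i (x : T) => x.1 i)
    (fun x => c (q x))
  choose m hm hmmin using fun i => Finset.exists_min_image σ (fun x : T => x.1 i) hσ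
  have hsum : N < ∑ i ∈ C, ((m i).1 i + 1) := by
    by_contra! hlt
    obtain ⟨j, hj⟩ : C.Nonempty := hC ▸ hσ.image _
    obtain ⟨i, hi, hiy⟩ := hdom ⟨fun i => (if i ∈ C then (m i).1 i + 1 else 0) +
      (if i = j then N - ∑ i ∈ C, ((m i).1 i + 1) else 0), by
        rw [Finset.sum_add_distrib, Finset.sum_ite_mem, Finset.sum_ite_eq']
        simp only [Finset.univ_inter, Finset.mem_univ, if_true]
        omega⟩
    have := hiy (m i) (hm i)
    simp only [hi, if_true] at this
    omega
  have hcardC : C.card ≤ Fintype.card ι := Finset.card_le_univ C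
  rw [Finset.sum_add_distrib, Finset.sum_const, smul_eq_mul, mul_one] at hsum
  have hnear : ∀ x ∈ σ, ∀ i ∈ C, x.1 i ≤ (m i).1 i + Fintype.card ι := by
    intro x hx i hi
    have h1 : ∑ k ∈ C, x.1 k ≤ N :=
      (Finset.sum_le_sum_of_subset (Finset.subset_univ C)).trans x.2.le
    have h2 : ∑ k ∈ C.erase i, (m k).1 k ≤ ∑ k ∈ C.erase i, x.1 k :=
      Finset.sum_le_sum fun k _ => hmmin k x hx
    rw [← Finset.add_sum_erase _ _ hi] at h1 hsum
    omega
  have hout : ∀ x ∈ σ, ∀ i, i ∉ C → x.1 i ≤ Fintype.card ι := by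
    intro x hx i hi
    have h1 : ∑ k ∈ insert i C, x.1 k ≤ N :=
      (Finset.sum_le_sum_of_subset (Finset.subset_univ _)).trans x.2.le
    rw [Finset.sum_insert hi] at h1
    have h2 : ∑ k ∈ C, (m k).1 k ≤ ∑ k ∈ C, x.1 k :=
      Finset.sum_le_sum fun k _ => hmmin k x hx
    omega
  have hpick : ∀ i, ∃ x ∈ σ, c (q x) = i ∨ x.1 i ≤ Fintype.card ι := by
    intro i
    by_cases hi : i ∈ C
    · rw [← hC] at hi
      obtain ⟨x, hx, hxi⟩ := Finset.mem_image.1 hi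
      exact ⟨x, hx, Or.inl hxi⟩
    · obtain ⟨x, hx⟩ := hσ
      exact ⟨x, hx, Or.inr (hout x hx i hi)⟩
  choose x hx hxi using hpick
  have hdiff : ∀ y ∈ σ, ∀ z ∈ σ, ∀ k, y.1 k ≤ z.1 k + Fintype.card ι := by
    intro y hy z hz k
    by_cases hk : k ∈ C
    · exact (hnear y hy k hk).trans (Nat.add_le_add_right (hmmin k z hz) _)
    · exact (hout y hy k hk).trans (Nat.le_add_left _ _)
  refine ⟨fun i => q (x i), fun i => ⟨fun k => by positivity, ?_⟩, fun i j k => ?_, fun i => ?_⟩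
  · simp only [hq]
    rw [← Finset.sum_div, ← Nat.cast_sum, (x i).2, div_self hN'.ne']
  · have h1 : ((x i).1 k : ℝ) ≤ (x j).1 k + Fintype.card ι := by
      exact_mod_cast hdiff _ (hx i) _ (hx j) k
    have h2 : ((x j).1 k : ℝ) ≤ (x i).1 k + Fintype.card ι := by
      exact_mod_cast hdiff _ (hx j) _ (hx i) k
    simp only [hq]
    rw [← sub_div, abs_div, abs_of_pos hN']
    gcongr
    rw [abs_le]
    constructor <;> linarith
  · refine (hxi i).imp id fun h => ?_
    simp only [hq]
    gcongr

/-- A covering theorem of Knaster–Kuratowski–Mazurkiewicz type: if closed sets `F i` cover the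
standard simplex, some point lies in every `F i` whose coordinate does not vanish there. -/
theorem exists_mem_of_closed_cover [Nonempty ι] (F : ι → Set (ι → ℝ)) (hF : ∀ i, IsClosed (F i))
    (hcov : ∀ z ∈ stdSimplex ℝ ι, ∃ i, z ∈ F i) :
    ∃ z ∈ stdSimplex ℝ ι, ∀ i, z i = 0 ∨ z ∈ F i := by
  choose! c hc using hcov
  choose z hz hclose hcol using fun n : ℕ => exists_clustered_grid_points c (Nat.succ_pos n)
  obtain ⟨i₀⟩ := ‹Nonempty ι›
  obtain ⟨w, hw, φ, hφ, hlim⟩ := (isCompact_stdSimplex ℝ ι).tendsto_subseq (fun n => hz n i₀)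
  have hsmall : Filter.Tendsto (fun n : ℕ => (Fintype.card ι : ℝ) / ((φ n).succ : ℕ))
      Filter.atTop (nhds 0) :=
    ((tendsto_const_div_atTop_nhds_zero_nat (Fintype.card ι : ℝ)).comp
      (Filter.tendsto_add_atTop_nat 1)).comp hφ.tendsto_atTop
  have hlimi : ∀ i, Filter.Tendsto (fun n => z (φ n) i) Filter.atTop (nhds w) := by
    intro i
    rw [tendsto_pi_nhds]
    intro k
    have h1 : Filter.Tendsto (fun n => z (φ n) i k - z (φ n) i₀ k) Filter.atTop (nhds 0) :=
      squeeze_zero_norm (fun n => hclose (φ n) i i₀ k) hsmall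
    have h2 := h1.add ((tendsto_pi_nhds.1 hlim) k)
    simpa using h2
  refine ⟨w, hw, fun i => ?_⟩
  by_cases hfreq : ∃ᶠ n in Filter.atTop, c (z (φ n) i) = i
  · right
    refine (hF i).mem_of_frequently_of_tendsto (hfreq.mono fun n hn => ?_) (hlimi i)
    have := hc _ (hz (φ n) i)
    rwa [hn] at this
  · left
    rw [Filter.not_frequently] at hfreq
    refine le_antisymm ?_ (hw.1 i)
    exact le_of_tendsto_of_tendsto ((tendsto_pi_nhds.1 (hlimi i)) i) hsmall
      (hfreq.mono fun n hn => (hcol (φ n) i).resolve_left hn)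

/-- Nash's existence theorem in variational form: for message payoffs depending continuously on
the mixed profile there is a mixed profile all of whose played messages are best responses. -/
theorem exists_equilibrium {K : Type*} [Fintype K] (M : K → Type*) [∀ k, Fintype (M k)]
    [∀ k, Nonempty (M k)] (φ : (∀ k, M k → ℝ) → ∀ k, M k → ℝ)
    (hφ : ∀ k m, Continuous fun σ => φ σ k m) :
    ∃ σ : ∀ k, M k → ℝ, (∀ k, (∀ m, 0 ≤ σ k m) ∧ ∑ m, σ k m = 1) ∧
      ∀ k m, 0 < σ k m → ∀ m', φ σ k m' ≤ φ σ k m := by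
  rcases isEmpty_or_nonempty K with hK | hK
  · exact ⟨fun k => isEmptyElim k, fun k => isEmptyElim k, fun k => isEmptyElim k⟩
  have : Nonempty (Σ k, M k) := ⟨⟨Classical.arbitrary K, Classical.arbitrary _⟩⟩
  set n : ℝ := (Fintype.card K : ℝ) with hn
  have hnpos : 0 < n := by simp [hn, Fintype.card_pos]
  set prof : ((Σ k, M k) → ℝ) → ∀ k, M k → ℝ := fun z k m => n * z ⟨k, m⟩ with hprof
  have hprofc : Continuous prof := by fun_prop
  set b : ((Σ k, M k) → ℝ) → K → ℝ := fun z k => ∑ m, z ⟨k, m⟩ with hb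
  have hbc : ∀ k, Continuous fun z => b z k := fun k => by fun_prop
  set F : (Σ k, M k) → Set ((Σ k, M k) → ℝ) := fun p =>
    {z | (∀ l, b z p.1 ≤ b z l) ∧ ∀ m', φ (prof z) p.1 m' ≤ φ (prof z) p.1 p.2} with hF
  have hFcl : ∀ p, IsClosed (F p) := by
    intro p
    simp only [hF, Set.ofPred_and, Set.ofPred_forall]
    exact (isClosed_iInter fun l => isClosed_le (hbc _) (hbc _)).inter
      (isClosed_iInter fun m' => isClosed_le ((hφ _ _).comp hprofc) ((hφ _ _).comp hprofc))
  obtain ⟨z, hz, hzF⟩ := exists_mem_of_closed_cover F hFcl (by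
    intro z _
    obtain ⟨k, hk⟩ := Finite.exists_min (b z)
    obtain ⟨m, hm⟩ := Finite.exists_max (φ (prof z) k)
    exact ⟨⟨k, m⟩, hk, hm⟩)
  have htot : ∑ k, b z k = 1 := by
    rw [← hz.2, Fintype.sum_sigma]
  have hmin : ∀ k, 0 < b z k → ∀ l, b z k ≤ b z l := by
    intro k hk
    obtain ⟨m, -, hm⟩ := Finset.exists_lt_of_sum_lt (s := Finset.univ) (f := fun _ : M k => (0 : ℝ))
      (g := fun m => z ⟨k, m⟩) (by simpa [hb] using hk)
    exact ((hzF ⟨k, m⟩).resolve_left hm.ne').1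
  obtain ⟨k₀, -, hk₀⟩ := Finset.exists_lt_of_sum_lt (s := Finset.univ) (f := fun _ : K => (0 : ℝ))
      (g := b z) (by simp [htot])
  have heq : ∀ k, b z k = b z k₀ := fun k =>
    le_antisymm (hmin k (hk₀.trans_le (hmin k₀ hk₀ k)) k₀) (hmin k₀ hk₀ k)
  have hbn : ∀ k, n * b z k = 1 := by
    intro k
    rw [← htot, Finset.sum_congr rfl fun l _ => (heq l).trans (heq k).symm]
    simp [hn]
  refine ⟨prof z, fun k => ⟨fun m => mul_nonneg hnpos.le (hz.1 _), ?_⟩, fun k m hm => ?_⟩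
  · rw [← hbn k, hb, Finset.mul_sum]
  · have : z ⟨k, m⟩ ≠ 0 := fun h => by simp [hprof, h] at hm
    exact ((hzF ⟨k, m⟩).resolve_left this).2

end Covering

/-! ### Challenges and dictator outcomes -/

section Challenge

variable [Fintype A]

/-- Utility of agent `i` whose valuation of pure alternatives is `v`. -/
def util (v : A → ℝ) (i : Fin I) (x : OutcS A I) : ℝ :=
  (∑ a, (x.1 : A → ℝ) a * v a) + x.2 i

theorem exists_mixture {J : Type*} [Fintype J] (p : J → ℝ) (hp : ∀ j, 0 ≤ p j)
    (hp1 : ∑ j, p j = 1) (x : J → OutcS A I) :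
    ∃ y : OutcS A I, ∀ v i, util v i y = ∑ j, p j * util v i (x j) := by
  refine ⟨(⟨∑ j, p j • ((x j).1 : A → ℝ), (convex_stdSimplex ℝ A).sum_mem (fun j _ => hp j) hp1
    fun j _ => (x j).1.2⟩, ∑ j, p j • (x j).2), fun v i => ?_⟩
  change (∑ a, (∑ j, p j • ((x j).1 : A → ℝ)) a * v a) + (∑ j, p j • (x j).2) i = _
  simp only [util, Finset.sum_apply, Pi.smul_apply, smul_eq_mul, mul_add, Finset.sum_add_distrib,
    Finset.sum_mul, Finset.mul_sum]
  rw [Finset.sum_comm]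
  simp only [mul_assoc]

variable {Q : Type}

/-- Outcomes rewarding a truthful report of one's own preferences, made arbitrarily bad for
everybody by a lump-sum payment. -/
theorem exists_dictator_outcomes [Finite Q] [Nonempty A] (t : Q → Fin I → A → ℝ)
    (ht : ∀ q i, ∑ x, t q i x = 0) (L : ℝ) :
    ∃ y : Fin I → Q → OutcS A I,
      (∀ k a q, t a k ≠ t q k → util (t q k) k (y k a) < util (t q k) k (y k q)) ∧
      ∀ k a q j, util (t q j) j (y k a) < L := by
  obtain ⟨B, hB⟩ := Finite.exists_le (fun p : Q × Fin I × A => |t p.1 p.2.1 p.2.2|)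
  set n : ℝ := (Fintype.card A : ℝ) with hn
  have hnpos : 0 < n := by simp [hn, Fintype.card_pos]
  set e : ℝ := 1 / (n * (|B| + 1)) with he
  have hepos : 0 < e := by positivity
  have hprob : ∀ q i x, 0 ≤ 1 / n + e * t q i x := by
    intro q i x
    have h1 : |t q i x| ≤ |B| + 1 := (hB (q, i, x)).trans ((le_abs_self B).trans (by linarith))
    have h2 : e * (|B| + 1) = 1 / n := by
      rw [he]
      field_simp
    nlinarith [neg_abs_le (t q i x)]
  set ℓ : Fin I → Q → Lot A := fun k a => ⟨fun x => 1 / n + e * t a k x, fun x => hprob a k x, by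
    rw [Finset.sum_add_distrib, ← Finset.mul_sum, ht]
    simp [← hn, hnpos.ne']⟩ with hℓ
  set y₀ : Fin I → Q → OutcS A I := fun k a => (ℓ k a, fun _ => -(e / 2 * ∑ x, t a k x ^ 2))
    with hy₀
  obtain ⟨P, hP⟩ := Finite.exists_le
    (fun p : Fin I × Q × Q × Fin I => util (t p.2.2.1 p.2.2.2) p.2.2.2 (y₀ p.1 p.2.1))
  have hshift : ∀ v i k a, util v i ((y₀ k a).1, fun i => (y₀ k a).2 i - (P - L + 1)) =
      util v i (y₀ k a) - (P - L + 1) := by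
    intro v i k a
    simp only [util]
    ring
  refine ⟨fun k a => ((y₀ k a).1, fun i => (y₀ k a).2 i - (P - L + 1)), ?_, ?_⟩
  · intro k a q hne
    rw [hshift, hshift]
    have hval : ∀ a, util (t q k) k (y₀ k a) =
        e * ∑ x, t a k x * t q k x - e / 2 * ∑ x, t a k x ^ 2 := by
      intro a
      have : ∀ x, (1 / n + e * t a k x) * t q k x =
          1 / n * t q k x + e * (t a k x * t q k x) := fun x => by ring
      change ∑ x, (1 / n + e * t a k x) * t q k x + -(e / 2 * ∑ x, t a k x ^ 2) = _
      simp only [this, Finset.sum_add_distrib, ← Finset.mul_sum, ht]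
      ring
    rw [hval, hval]
    have hpos : 0 < ∑ x, (t a k x - t q k x) ^ 2 := by
      obtain ⟨x, hx⟩ := Function.ne_iff.1 hne
      exact Finset.sum_pos' (fun x _ => sq_nonneg _)
        ⟨x, Finset.mem_univ _, by have := sub_ne_zero.2 hx; positivity⟩
    have hexp : ∑ x, (t a k x - t q k x) ^ 2 =
        ∑ x, t a k x ^ 2 - 2 * ∑ x, t a k x * t q k x + ∑ x, t q k x ^ 2 := by
      rw [Finset.mul_sum, ← Finset.sum_sub_distrib, ← Finset.sum_add_distrib]
      exact Finset.sum_congr rfl fun x _ => by ring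
    have hqq : ∑ x, t q k x * t q k x = ∑ x, t q k x ^ 2 :=
      Finset.sum_congr rfl fun x _ => by ring
    rw [hqq]
    nlinarith
  · intro k a q j
    rw [hshift]
    have := hP (k, a, q, j)
    dsimp only at this
    linarith

/-- Agent `j` with preferences `a` can challenge the announcement `b`: some outcome is better than
`F b` under `a`, but not under `b`. -/
def Challenges (t : Q → Fin I → A → ℝ) (F : Q → OutcS A I) (j : Fin I) (b a : Q) : Prop :=
  ∃ x, util (t b j) j x ≤ util (t b j) j (F b) ∧ util (t a j) j (F b) < util (t a j) j x

theorem not_challenges_self {t : Q → Fin I → A → ℝ} {F : Q → OutcS A I} {j : Fin I} {b a : Q}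
    (h : t a j = t b j) : ¬ Challenges t F j b a := by
  rintro ⟨x, h1, h2⟩
  rw [h] at h2
  exact absurd h1 (not_le.2 h2)

theorem Challenges.congr {t : Q → Fin I → A → ℝ} {F : Q → OutcS A I} {j : Fin I} {b a a' : Q}
    (h : t a j = t a' j) (hc : Challenges t F j b a) : Challenges t F j b a' := by
  unfold Challenges at hc ⊢
  rwa [h] at hc

theorem exists_best_challenge [Finite Q] (t : Q → Fin I → A → ℝ) (F : Q → OutcS A I) :
    ∃ X : Fin I → Q → Q → OutcS A I,
      (∀ j b a, ¬ Challenges t F j b a → X j b a = F b) ∧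
      (∀ j b a, Challenges t F j b a → util (t a j) j (F b) < util (t a j) j (X j b a)) ∧
      ∀ j b a a', util (t a j) j (X j b a') ≤ util (t a j) j (X j b a) := by
  have hopt : ∀ j b a, ∃ x, util (t b j) j x ≤ util (t b j) j (F b) ∧
      (Challenges t F j b a → util (t a j) j (F b) < util (t a j) j x) := by
    intro j b a
    by_cases h : Challenges t F j b a
    · obtain ⟨x, h1, h2⟩ := h
      exact ⟨x, h1, fun _ => h2⟩
    · exact ⟨F b, le_rfl, fun h' => absurd h' h⟩
  choose o ho1 ho2 using hopt
  have hbest : ∀ j b a, ∃ a₀, ∀ a', util (t a j) j (o j b a') ≤ util (t a j) j (o j b a₀) :=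
    fun j b a => by
      have : Nonempty Q := ⟨a⟩
      exact Finite.exists_max fun a' => util (t a j) j (o j b a')
  choose s hs using hbest
  set X : Fin I → Q → Q → OutcS A I := fun j b a =>
    if Challenges t F j b a then o j b (s j b a) else F b with hX
  have hX0 : ∀ j b a, util (t b j) j (X j b a) ≤ util (t b j) j (F b) := by
    intro j b a
    simp only [hX]
    split_ifs
    · exact ho1 _ _ _
    · exact le_rfl
  have hstrict : ∀ j b a, Challenges t F j b a →
      util (t a j) j (F b) < util (t a j) j (X j b a) := by
    intro j b a h
    simp only [hX, if_pos h]
    exact (ho2 j b a h).trans_le (hs j b a a)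
  refine ⟨X, fun j b a h => if_neg h, hstrict, fun j b a a' => ?_⟩
  by_cases h : Challenges t F j b a
  · by_cases h' : Challenges t F j b a'
    · simp only [hX, if_pos h, if_pos h']
      exact hs _ _ _ _
    · have : X j b a' = F b := if_neg h'
      rw [this]
      exact (hstrict j b a h).le
  · have : X j b a = F b := if_neg h
    rw [this]
    by_contra! hlt
    exact h ⟨_, hX0 j b a', hlt⟩

/-- The outcome contributed by each agent once some report is contested: a mixture of the best
challenge with a small weight on a dictator outcome. -/
structure ChallengeScheme (t : Q → Fin I → A → ℝ) (F : Q → OutcS A I) where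
  /-- `Z k b a` is contributed by agent `k` announcing the state `b` and the own type `a`. -/
  Z : Fin I → Q → Q → OutcS A I
  truth : ∀ k b a q, t a k ≠ t q k → util (t q k) k (Z k b a) < util (t q k) k (Z k b q)
  gain : ∀ j b q (s : Fin I → Q), Challenges t F j b q → s j = q →
    (∀ k, k ≠ j → ¬ Challenges t F k b (s k)) →
    I * util (t q j) j (F b) < ∑ k, util (t q j) j (Z k b (s k))
  loss : ∀ j b q (s : Fin I → Q), ¬ Challenges t F j b q →
    (∀ k, k ≠ j → ¬ Challenges t F k b (s k)) →
    ∑ k, util (t q j) j (Z k b (s k)) < I * util (t q j) j (F b)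

theorem exists_challengeScheme [Finite Q] [Nonempty A] (t : Q → Fin I → A → ℝ)
    (ht : ∀ q i, ∑ x, t q i x = 0) (F : Q → OutcS A I) :
    Nonempty (ChallengeScheme t F) := by
  obtain ⟨X, hXF, hXgain, hXbest⟩ := exists_best_challenge t F
  obtain ⟨δ, hδ, hδX⟩ : ∃ δ > 0, ∀ j b a, Challenges t F j b a →
      util (t a j) j (F b) + δ ≤ util (t a j) j (X j b a) := by
    obtain ⟨R, hR⟩ := Finite.exists_le (fun p : Fin I × Q × Q =>
      (util (t p.2.2 p.1) p.1 (X p.1 p.2.1 p.2.2) - util (t p.2.2 p.1) p.1 (F p.2.1))⁻¹)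
    refine ⟨(|R| + 1)⁻¹, by positivity, fun j b a h => ?_⟩
    have h1 : 0 < util (t a j) j (X j b a) - util (t a j) j (F b) := sub_pos.2 (hXgain j b a h)
    have h2 := (hR (j, b, a)).trans ((le_abs_self R).trans (le_add_of_nonneg_right zero_le_one))
    have h3 := inv_le_of_inv_le₀ h1 h2
    linarith
  obtain ⟨L, hL⟩ := Finite.exists_ge (fun p : Fin I × Q × Q => util (t p.2.2 p.1) p.1 (F p.2.1))
  obtain ⟨y, hytruth, hyL⟩ := exists_dictator_outcomes t ht L
  obtain ⟨B, hB⟩ := Finite.exists_le (fun p : Fin I × Q × Q × Fin I × Q =>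
    util (t p.2.2.1 p.1) p.1 (F p.2.1) - util (t p.2.2.1 p.1) p.1 (y p.2.2.2.1 p.2.2.2.2))
  have hB' : ∀ j b q k a, util (t q j) j (F b) - util (t q j) j (y k a) ≤ |B| :=
    fun j b q k a => (hB (j, b, q, k, a)).trans (le_abs_self B)
  set e : ℝ := δ / (δ + I * |B| + 1) with he
  have hden : 0 < δ + I * |B| + 1 := by positivity
  have he0 : 0 < e := by positivity
  have heδ : e * (δ + I * |B| + 1) = δ := div_mul_cancel₀ _ hden.ne'
  have he1 : e ≤ 1 := by
    rw [he, div_le_one hden]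
    have : 0 ≤ I * |B| := by positivity
    linarith
  have hmix : ∀ k b a, ∃ z : OutcS A I, ∀ v i,
      util v i z = (1 - e) * util v i (X k b a) + e * util v i (y k a) := by
    intro k b a
    obtain ⟨z, hz⟩ := exists_mixture ![1 - e, e]
      (by
        intro j
        fin_cases j
        · simpa using he1
        · simpa using he0.le)
      (by simp) ![X k b a, y k a]
    exact ⟨z, fun v i => by rw [hz]; simp⟩
  choose Z hZ using hmix
  have hsum : ∀ j b q (s : Fin I → Q), (∀ k, k ≠ j → ¬ Challenges t F k b (s k)) →
      ∑ k, util (t q j) j (Z k b (s k)) - I * util (t q j) j (F b) =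
        (1 - e) * (util (t q j) j (X j b (s j)) - util (t q j) j (F b)) +
          e * ∑ k, (util (t q j) j (y k (s k)) - util (t q j) j (F b)) := by
    intro j b q s hs
    have h1 : ∑ k, (util (t q j) j (X k b (s k)) - util (t q j) j (F b)) =
        util (t q j) j (X j b (s j)) - util (t q j) j (F b) :=
      Finset.sum_eq_single j (fun k _ hk => by rw [hXF k b _ (hs k hk), sub_self]) (by simp)
    rw [← h1]
    simp only [hZ, Finset.sum_sub_distrib, Finset.sum_add_distrib, ← Finset.mul_sum,
      Finset.sum_const, Finset.card_univ, Fintype.card_fin, nsmul_eq_mul]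
    ring
  refine ⟨⟨Z, fun k b a q h => ?_, fun j b q s hc hsj hs => ?_, fun j b q s hc hs => ?_⟩⟩
  · rw [hZ, hZ]
    have h1 := mul_lt_mul_of_pos_left (hytruth k a q h) he0
    have h2 := mul_le_mul_of_nonneg_left (hXbest k b q a) (sub_nonneg.2 he1)
    linarith
  · have h1 : -(I * |B|) ≤ ∑ k, (util (t q j) j (y k (s k)) - util (t q j) j (F b)) := by
      have := Finset.card_nsmul_le_sum Finset.univ
        (fun k => util (t q j) j (y k (s k)) - util (t q j) j (F b)) (-|B|)
        (fun k _ => by linarith [hB' j b q k (s k)])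
      simpa using this
    have h2 := hδX j b q hc
    have h3 := hsum j b q s hs
    rw [hsj] at h3
    have h4 := mul_le_mul_of_nonneg_left h1 he0.le
    have h5 := mul_le_mul_of_nonneg_left
      (show δ ≤ util (t q j) j (X j b q) - util (t q j) j (F b) by linarith) (sub_nonneg.2 he1)
    nlinarith
  · have h1 : ∑ k, (util (t q j) j (y k (s k)) - util (t q j) j (F b)) < 0 := by
      have h2 : ∀ k, util (t q j) j (y k (s k)) - util (t q j) j (F b) < 0 := fun k => by
        have := hL (j, b, q)
        dsimp only at this
        linarith [hyL k (s k) q j]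
      exact Finset.sum_neg (fun k _ => h2 k) ⟨j, Finset.mem_univ j⟩
    have h2 := hXbest j b q (s j)
    rw [hXF j b q hc] at h2
    have h3 := hsum j b q s hs
    have h4 := mul_neg_of_pos_of_neg he0 h1
    have h5 := mul_nonpos_of_nonneg_of_nonpos (sub_nonneg.2 he1) (sub_nonpos.2 h2)
    linarith

end Challenge

/-! ### The contest mechanism -/

section Contest

variable [Fintype A] {Q : Type} {t : Q → Fin I → A → ℝ} {F : Q → OutcS A I}

/-- All agents announce the same state `b`, and nobody's own type challenges it. -/
def QuietAt (t : Q → Fin I → A → ℝ) (F : Q → OutcS A I) (b : Q) (m : Fin I → Q × Q) : Prop :=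
  ∀ i, (m i).2 = b ∧ ¬ Challenges t F i b (m i).1

/-- A message profile is quiet if it is quiet at some announcement. -/
def Quiet (t : Q → Fin I → A → ℝ) (F : Q → OutcS A I) (m : Fin I → Q × Q) : Prop :=
  ∃ b, QuietAt t F b m

/-- The outcome is `F b` at quiet profiles, and otherwise the average of the contributions of
the agents. -/
def IsContestOutcome (C : ChallengeScheme t F) (g : (Fin I → Q × Q) → OutcS A I) : Prop :=
  (∀ m b, QuietAt t F b m → g m = F b) ∧
    ∀ m, ¬ Quiet t F m → ∀ v i, I * util v i (g m) = ∑ k, util v i (C.Z k (m k).2 (m k).1)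

theorem exists_isContestOutcome (hI : 0 < I) (C : ChallengeScheme t F) :
    ∃ g, IsContestOutcome C g := by
  have hI' : (I : ℝ) ≠ 0 := by exact_mod_cast hI.ne'
  have hmix : ∀ m : Fin I → Q × Q, ∃ z : OutcS A I, ∀ v i,
      I * util v i z = ∑ k, util v i (C.Z k (m k).2 (m k).1) := by
    intro m
    obtain ⟨z, hz⟩ := exists_mixture (fun _ : Fin I => (I : ℝ)⁻¹) (fun _ => by positivity)
      (by simp [hI']) fun k => C.Z k (m k).2 (m k).1
    refine ⟨z, fun v i => ?_⟩
    rw [hz, ← Finset.mul_sum, mul_inv_cancel_left₀ hI']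
  choose z hz using hmix
  refine ⟨fun m => if h : Quiet t F m then F h.choose else z m, fun m b hb => ?_, fun m hm => ?_⟩
  · have h : Quiet t F m := ⟨b, hb⟩
    have hbb : h.choose = b := (h.choose_spec ⟨0, hI⟩).1.symm.trans (hb ⟨0, hI⟩).1
    simp only [dif_pos h, hbb]
  · simp only [dif_neg hm]
    exact hz m

/-- Transfers penalising disagreement: towards each agent's own report about himself (`η`), and
towards the announcements of the others about oneself (`η'`). -/
def score (t : Q → Fin I → A → ℝ) (η η' : ℝ) (i : Fin I) (m : Fin I → Q × Q) : ℝ :=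
  η * (∑ k, if t (m i).2 k = t (m k).2 k then 0 else if t (m i).2 k = t (m k).1 k then 1 else -1)
    - η' * ∑ k, if t (m i).2 i = t (m k).2 i then 0 else 1

/-- Payoff of agent `j` with the preferences of state `q`. -/
def contestPay (t : Q → Fin I → A → ℝ) (g : (Fin I → Q × Q) → OutcS A I) (η η' : ℝ) (q : Q)
    (j : Fin I) (m : Fin I → Q × Q) : ℝ :=
  util (t q j) j (g m) + score t η η' j m

theorem score_update_self (η η' : ℝ) (j : Fin I) (m : Fin I → Q × Q) (a : Q) :
    score t η η' j (Function.update m j (a, (m j).2)) = score t η η' j m := by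
  have h2 : ∀ k, (Function.update m j (a, (m j).2) k).2 = (m k).2 := by
    intro k
    rcases eq_or_ne k j with rfl | hk
    · simp
    · simp [hk]
  unfold score
  congr 2
  · refine Finset.sum_congr rfl fun k _ => ?_
    rcases eq_or_ne k j with rfl | hk
    · simp
    · simp [hk]
  · simp only [h2]

theorem QuietAt.score_eq_zero {b : Q} {m : Fin I → Q × Q} (h : QuietAt t F b m) (η η' : ℝ)
    (j : Fin I) : score t η η' j m = 0 := by
  have h2 : ∀ k, (m k).2 = b := fun k => (h k).1
  simp [score, h2]

theorem QuietAt.update {b : Q} {m : Fin I → Q × Q} (h : QuietAt t F b m) {j : Fin I} {x : Q × Q}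
    (hx : x.2 = b) (hxb : ¬ Challenges t F j b x.1) : QuietAt t F b (Function.update m j x) := by
  intro i
  rcases eq_or_ne i j with rfl | hi
  · simpa using ⟨hx, hxb⟩
  · simpa [hi] using h i

/-- Reporting a false own type is strictly worse than reporting the true one, unless the outcome
is quiet in both cases. -/
theorem contestPay_update_of_lie {C : ChallengeScheme t F} {g : (Fin I → Q × Q) → OutcS A I}
    (hg : IsContestOutcome C g) (η η' : ℝ) {q : Q} {j : Fin I} {m : Fin I → Q × Q}
    (hlie : t (m j).1 j ≠ t q j) :
    (Quiet t F m ∧ Quiet t F (Function.update m j (q, (m j).2)) ∧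
      contestPay t g η η' q j m =
        contestPay t g η η' q j (Function.update m j (q, (m j).2))) ∨
    contestPay t g η η' q j m <
      contestPay t g η η' q j (Function.update m j (q, (m j).2)) := by
  have hI : (0 : ℝ) < I := by exact_mod_cast (Nat.zero_le _).trans_lt j.isLt
  have hback : Function.update (Function.update m j (q, (m j).2)) j (m j) = m := by simp
  have hj : Function.update m j (q, (m j).2) j = (q, (m j).2) := by simp
  have hk : ∀ k, k ≠ j → Function.update m j (q, (m j).2) k = m k := fun k h => by simp [h]
  have hscore : score t η η' j (Function.update m j (q, (m j).2)) = score t η η' j m :=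
    score_update_self η η' j m q
  set m' := Function.update m j (q, (m j).2) with hm'
  simp only [contestPay, hscore, add_left_inj, add_lt_add_iff_right]
  have hsnd : ∀ k, (m' k).2 = (m k).2 := by
    intro k
    rcases eq_or_ne k j with rfl | h
    · rw [hj]
    · rw [hk k h]
  by_cases hq : Quiet t F m <;> by_cases hq' : Quiet t F m'
  · left
    refine ⟨hq, hq', ?_⟩
    obtain ⟨b, hb⟩ := hq
    obtain ⟨b', hb'⟩ := hq'
    have : b' = b := by rw [← (hb j).1, ← (hb' j).1, hsnd]
    rw [hg.1 m b hb, hg.1 m' b' hb', this]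
  · right
    obtain ⟨b, hb⟩ := hq
    have hc : Challenges t F j b q := by
      by_contra hc
      exact hq' ⟨b, hb.update (hb j).1 hc⟩
    have h1 := C.gain j b q (fun k => (m' k).1) hc (by simp [hj])
      (fun k h => by simpa [hk k h] using (hb k).2)
    have h2 := hg.2 m' hq' (t q j) j
    simp only [hsnd, (hb _).1] at h2
    rw [← h2] at h1
    rw [hg.1 m b hb]
    exact lt_of_mul_lt_mul_left h1 hI.le
  · right
    obtain ⟨b, hb⟩ := hq'
    have hc : ¬ Challenges t F j b q := by simpa [hj] using (hb j).2
    have h1 := C.loss j b q (fun k => (m k).1) hc (fun k h => by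
      have := (hb k).2
      rwa [hk k h] at this)
    have h2 := hg.2 m hq (t q j) j
    simp only [← hsnd, (hb _).1] at h2
    rw [← h2] at h1
    rw [hg.1 m' b hb]
    exact lt_of_mul_lt_mul_left h1 hI.le
  · right
    refine lt_of_mul_lt_mul_left ?_ hI.le
    rw [hg.2 m hq, hg.2 m' hq']
    refine Finset.sum_lt_sum (fun k _ => ?_) ⟨j, Finset.mem_univ j, ?_⟩
    · rcases eq_or_ne k j with rfl | h
      · rw [hj]
        exact (C.truth k _ _ q hlie).le
      · rw [hk k h]
    · rw [hj]
      exact C.truth j _ _ q hlie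

/-- Message sets all of whose members are undominated within the sets. -/
def UndominatedSets {M : Fin I → Type} (W : Fin I → (∀ i, M i) → ℝ) (S : ∀ i, Set (M i)) : Prop :=
  ∀ i, ∀ x ∈ S i, ∀ x', (∀ m, (∀ k, m k ∈ S k) → m i = x → W i m ≤ W i (Function.update m i x')) →
    ∀ m, (∀ k, m k ∈ S k) → m i = x → W i (Function.update m i x') ≤ W i m

section Analysis

variable {C : ChallengeScheme t F} {g : (Fin I → Q × Q) → OutcS A I} {η η' K : ℝ} {q : Q}
  {S : Fin I → Set (Q × Q)}

theorem UndominatedSets.quiet_of_lie (hS : UndominatedSets (contestPay t g η η' q) S)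
    (hg : IsContestOutcome C g) {m : Fin I → Q × Q} (hm : ∀ k, m k ∈ S k) {j : Fin I}
    (hlie : t (m j).1 j ≠ t q j) :
    Quiet t F m ∧ Quiet t F (Function.update m j (q, (m j).2)) := by
  have key := hS j (m j) (hm j) (q, (m j).2) (fun m' _ hj => by
    rw [← hj] at hlie ⊢
    rcases contestPay_update_of_lie hg η η' hlie with h | h
    · exact h.2.2.le
    · exact h.le) m hm rfl
  rcases contestPay_update_of_lie hg η η' hlie with h | h
  · exact ⟨h.1, h.2.1⟩
  · exact absurd key (not_le.2 h)

theorem UndominatedSets.no_gain (hS : UndominatedSets (contestPay t g η η' q) S)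
    (hK : ∀ j m, |util (t q j) j (g m)| ≤ K) (hne : ∀ k, (S k).Nonempty) {j : Fin I} {x x' : Q × Q}
    (hx : x ∈ S j)
    (h : ∀ m, (∀ k, m k ∈ S k) → m j = x →
      score t η η' j m + 2 * K < score t η η' j (Function.update m j x')) : False := by
  have hlt : ∀ m, (∀ k, m k ∈ S k) → m j = x →
      contestPay t g η η' q j m < contestPay t g η η' q j (Function.update m j x') := by
    intro m hm hmj
    have h1 := h m hm hmj
    have h2 := abs_le.1 (hK j m)
    have h3 := abs_le.1 (hK j (Function.update m j x'))
    simp only [contestPay]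
    linarith
  choose y hy using hne
  have hm : ∀ k, Function.update y j x k ∈ S k := by
    intro k
    rcases eq_or_ne k j with rfl | hk
    · simpa using hx
    · simpa [hk] using hy k
  have hmj : Function.update y j x j = x := by simp
  exact absurd (hS j x hx x' (fun m hm hmj => (hlt m hm hmj).le) _ hm hmj)
    (not_le.2 (hlt _ hm hmj))

theorem UndominatedSets.announce_others (hS : UndominatedSets (contestPay t g η η' q) S)
    (hK : ∀ j m, |util (t q j) j (g m)| ≤ K) (hη' : 0 ≤ η') (hη : I * η' + 2 * K < η) (hK0 : 0 ≤ K)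
    (hne : ∀ k, (S k).Nonempty) {j : Fin I}
    (htrue : ∀ k, k ≠ j → ∀ x ∈ S k, t x.1 k = t q k) {x : Q × Q} (hx : x ∈ S j) {k : Fin I}
    (hk : k ≠ j) : t x.2 k = t q k := by
  by_contra hxk
  refine hS.no_gain hK hne hx (x' := (x.1, q)) fun m hm hmj => ?_
  have hη0 : 0 < η := lt_of_le_of_lt (by positivity) hη
  have h1 : ∑ l, (if t (m j).2 l = t (m l).2 l then (0 : ℝ) else
      if t (m j).2 l = t (m l).1 l then 1 else -1) + 1 ≤
      ∑ l, (if t (Function.update m j (x.1, q) j).2 l = t (Function.update m j (x.1, q) l).2 l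
        then (0 : ℝ) else
        if t (Function.update m j (x.1, q) j).2 l = t (Function.update m j (x.1, q) l).1 l
        then 1 else -1) := by
    rw [← Finset.sum_erase_add _ _ (Finset.mem_univ k),
      ← Finset.sum_erase_add Finset.univ (fun l => ite (_ = _) _ _) (Finset.mem_univ k), add_assoc]
    refine add_le_add (Finset.sum_le_sum fun l _ => ?_) ?_
    · rcases eq_or_ne l j with rfl | hl
      · simp
      · have := htrue l hl _ (hm l)
        simp only [Function.update_self, Function.update_of_ne hl, hmj, this]
        split_ifs <;> simp_all
    · have := htrue k hk _ (hm k)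
      simp only [Function.update_self, Function.update_of_ne hk, hmj, this, hxk, if_false]
      split_ifs <;> simp_all
  have h2 : 0 ≤ ∑ l, (if t (m j).2 j = t (m l).2 j then (0 : ℝ) else 1) :=
    Finset.sum_nonneg fun l _ => by split_ifs <;> norm_num
  have h3 : ∑ l, (if t (Function.update m j (x.1, q) j).2 j =
      t (Function.update m j (x.1, q) l).2 j then (0 : ℝ) else 1) ≤ I := by
    refine (Finset.sum_le_card_nsmul _ _ 1 fun l _ => ?_).trans (by simp)
    split_ifs <;> norm_num
  unfold score
  have h4 := mul_le_mul_of_nonneg_left h1 hη0.le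
  have h5 := mul_le_mul_of_nonneg_left h3 hη'
  have h6 := mul_nonneg hη' h2
  linarith

theorem UndominatedSets.announce_eq (hS : UndominatedSets (contestPay t g η η' q) S)
    (hK : ∀ j m, |util (t q j) j (g m)| ≤ K) (hη' : 2 * K < η') (hK0 : 0 ≤ K) (hI : 2 ≤ I)
    (ht : Function.Injective t) (hne : ∀ k, (S k).Nonempty) {j : Fin I} {y : Q × Q} (hy : y ∈ S j)
    {b : Q} (hself : ∀ k, k ≠ j → ∀ x ∈ S k, t x.2 j = t b j)
    (hothers : ∀ k, k ≠ j → t y.2 k = t b k) : y.2 = b := by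
  by_contra hyb
  have hj : t y.2 j ≠ t b j := by
    intro h
    refine hyb (ht (funext fun k => ?_))
    rcases eq_or_ne k j with rfl | hk
    · exact h
    · exact hothers k hk
  have : Nontrivial (Fin I) := Fin.nontrivial_iff_two_le.2 hI
  obtain ⟨l, hl⟩ := exists_ne j
  refine hS.no_gain hK hne hy (x' := (y.1, b)) fun m hm hmj => ?_
  have h1 : ∑ k, (if t (m j).2 k = t (m k).2 k then (0 : ℝ) else
      if t (m j).2 k = t (m k).1 k then 1 else -1) =
      ∑ k, (if t (Function.update m j (y.1, b) j).2 k = t (Function.update m j (y.1, b) k).2 k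
        then (0 : ℝ) else
        if t (Function.update m j (y.1, b) j).2 k = t (Function.update m j (y.1, b) k).1 k
        then 1 else -1) := by
    refine Finset.sum_congr rfl fun k _ => ?_
    rcases eq_or_ne k j with rfl | hk
    · simp
    · simp only [Function.update_self, Function.update_of_ne hk, hmj, hothers k hk]
  have h2 : 1 ≤ ∑ k, (if t (m j).2 j = t (m k).2 j then (0 : ℝ) else 1) := by
    refine le_trans ?_ (Finset.single_le_sum (fun k _ => ?_) (Finset.mem_univ l))
    · rw [hmj, hself l hl _ (hm l), if_neg hj]
    · split_ifs <;> norm_num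
  have h3 : ∑ k, (if t (Function.update m j (y.1, b) j).2 j =
      t (Function.update m j (y.1, b) k).2 j then (0 : ℝ) else 1) = 0 := by
    refine Finset.sum_eq_zero fun k _ => ?_
    rcases eq_or_ne k j with rfl | hk
    · simp
    · simp [Function.update_of_ne hk, hself k hk _ (hm k)]
  unfold score
  rw [h1, h3]
  have h4 := mul_le_mul_of_nonneg_left h2 (show 0 ≤ η' by linarith)
  linarith

theorem UndominatedSets.quiet (hS : UndominatedSets (contestPay t g η η' q) S)
    (hg : IsContestOutcome C g) (hK : ∀ j m, |util (t q j) j (g m)| ≤ K) (hK0 : 0 ≤ K)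
    (hη' : 2 * K < η') (hη : I * η' + 2 * K < η) (hI : 2 ≤ I) (ht : Function.Injective t)
    {m : Fin I → Q × Q} (hm : ∀ k, m k ∈ S k) : Quiet t F m := by
  by_contra hnq
  have hne : ∀ k, (S k).Nonempty := fun k => ⟨m k, hm k⟩
  have hη'0 : 0 ≤ η' := by linarith
  have hupd : ∀ m : Fin I → Q × Q, (∀ k, m k ∈ S k) → ∀ j, ∀ x ∈ S j,
      ∀ k, Function.update m j x k ∈ S k := by
    intro m hm j x hx k
    rcases eq_or_ne k j with rfl | hk
    · simpa using hx
    · simpa [hk] using hm k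
  by_cases hlie : ∃ j, ∃ x ∈ S j, t x.1 j ≠ t q j
  · obtain ⟨j, x, hx, hxj⟩ := hlie
    have hother : ∀ k, k ≠ j → ∀ y ∈ S k, y.2 = x.2 ∧ ¬ Challenges t F k x.2 y.1 := by
      intro k hk y hy
      obtain ⟨b, hb⟩ := (hS.quiet_of_lie hg (hupd _ (hupd m hm k y hy) j x hx)
        (j := j) (by simpa using hxj)).1
      have hbx : x.2 = b := by simpa using (hb j).1
      have hbk := hb k
      rw [Function.update_of_ne hk, Function.update_self] at hbk
      rwa [hbx]
    have hself : ¬ Challenges t F j x.2 q := by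
      obtain ⟨b, hb⟩ := (hS.quiet_of_lie hg (hupd m hm j x hx) (j := j)
        (by simpa using hxj)).2
      have hbj := hb j
      simp only [Function.update_self] at hbj
      rw [hbj.1]
      exact hbj.2
    refine hnq ⟨x.2, fun k => ?_⟩
    rcases ne_or_eq k j with hk | rfl
    · exact hother k hk _ (hm k)
    by_cases hlie' : ∃ l, l ≠ k ∧ ∃ y ∈ S l, t y.1 l ≠ t q l
    · obtain ⟨l, hl, y, hy, hyl⟩ := hlie'
      obtain ⟨b, hb⟩ := (hS.quiet_of_lie hg (hupd m hm l y hy) (j := l)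
        (by simpa using hyl)).1
      have hbl : y.2 = b := by simpa using (hb l).1
      have hbk := hb k
      rw [Function.update_of_ne hl.symm] at hbk
      rwa [← (hother l hl y hy).1, hbl]
    · push Not at hlie'
      have htrue := fun z (hz : z ∈ S k) l (hl : l ≠ k) =>
        hS.announce_others hK hη'0 hη hK0 hne hlie' hz hl
      have heq : (m k).2 = x.2 := hS.announce_eq hK hη' hK0 hI ht hne (hm k)
        (fun l hl y hy => by rw [(hother l hl y hy).1])
        (fun l hl => (htrue _ (hm k) l hl).trans (htrue x hx l hl).symm)
      refine ⟨heq, fun hc => ?_⟩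
      by_cases hmk : t (m k).1 k = t q k
      · exact hself (hc.congr hmk)
      · exact hnq (hS.quiet_of_lie hg hm hmk).1
  · push Not at hlie
    have htrue := fun j z (hz : z ∈ S j) k (hk : k ≠ j) =>
      hS.announce_others hK hη'0 hη hK0 hne (fun k _ => hlie k) hz hk
    have heq : ∀ j, (m j).2 = q := fun j => hS.announce_eq hK hη' hK0 hI ht hne (hm j)
      (fun k hk x hx => htrue k x hx j hk.symm) (fun k hk => htrue j _ (hm j) k hk)
    exact hnq ⟨q, fun j => ⟨heq j, not_challenges_self (hlie j _ (hm j))⟩⟩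

/-- Profiles in undominated message sets are quiet, at an announcement nobody would challenge. -/
theorem UndominatedSets.exists_quietAt (hS : UndominatedSets (contestPay t g η η' q) S)
    (hg : IsContestOutcome C g) (hK : ∀ j m, |util (t q j) j (g m)| ≤ K) (hK0 : 0 ≤ K)
    (hη' : 2 * K < η') (hη : I * η' + 2 * K < η) (hI : 2 ≤ I) (ht : Function.Injective t)
    {m : Fin I → Q × Q} (hm : ∀ k, m k ∈ S k) :
    ∃ b, QuietAt t F b m ∧ ∀ j, ¬ Challenges t F j b q := by
  obtain ⟨b, hb⟩ := hS.quiet hg hK hK0 hη' hη hI ht hm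
  refine ⟨b, hb, fun j hc => ?_⟩
  by_cases hmj : t (m j).1 j = t q j
  · exact (hb j).2 (hc.congr hmj.symm)
  · obtain ⟨b', hb'⟩ := (hS.quiet_of_lie hg hm hmj).2
    have h := hb' j
    simp only [Function.update_self, (hb j).1] at h
    rw [← h.1] at h
    exact h.2 hc

end Analysis

end Contest

/-! ### Bayesian Nash equilibria -/

section Equilibria

variable [Fintype Θ] [Fintype A] {w : Fin I → A → Θ → ℝ} {𝓜 : FinMechS A I}

theorem exists_isBNE (w : Fin I → A → Θ → ℝ) (𝓜 : FinMechS A I) (ν : Θ × Sig Θ I → ℝ) :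
    ∃ σ, IsBNE w 𝓜 ν σ := by
  obtain ⟨σ, hσ, hbest⟩ := exists_equilibrium (fun k : Fin I × Θ => 𝓜.M k.1)
    (fun σ k m => interimPay w 𝓜 ν (fun i s => σ (i, s)) k.1 k.2 m) (by
      intro k m
      unfold interimPay
      fun_prop)
  exact ⟨fun i s => σ (i, s), fun i s => hσ (i, s), fun i s => hbest (i, s)⟩

theorem sum_prod_eq_one {M : Fin I → Type} [∀ i, Fintype (M i)] {ρ : ∀ i, M i → ℝ}
    (h : ∀ i, ∑ x, ρ i x = 1) : ∑ m : ∀ i, M i, ∏ j, ρ j (m j) = 1 := by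
  rw [← Fintype.prod_sum, Finset.prod_congr rfl fun i _ => h i, Finset.prod_const_one]

theorem sum_prod_erase_ite {M : Fin I → Type} [∀ i, Fintype (M i)] (ρ : ∀ i, M i → ℝ) (i : Fin I)
    (h : ∑ x, ρ i x = 1) (P : (∀ i, M i) → ℝ) (z : M i) :
    ∑ m : ∀ j, M j, (∏ j ∈ Finset.univ.erase i, ρ j (m j)) * (if m i = z then P m else 0) =
      ∑ m : ∀ j, M j, (∏ j, ρ j (m j)) * P (Function.update m i z) := by
  set E := (Equiv.piSplitAt i M).symm with hE
  have hEi : ∀ x y, E (x, y) i = x := fun x y => by simp [hE]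
  have hEj : ∀ x y j (hj : j ≠ i), E (x, y) j = y ⟨j, hj⟩ := fun x y j hj => by simp [hE, hj]
  have hupd : ∀ x y, Function.update (E (x, y)) i z = E (z, y) := by
    intro x y
    funext j
    rcases eq_or_ne j i with rfl | hj
    · rw [Function.update_self, hEi]
    · rw [Function.update_of_ne hj, hEj _ _ _ hj, hEj _ _ _ hj]
  have hprod : ∀ x y, ∏ j ∈ Finset.univ.erase i, ρ j (E (x, y) j) =
      ∏ j ∈ Finset.univ.erase i, ρ j (E (z, y) j) := by
    intro x y
    refine Finset.prod_congr rfl fun j hj => ?_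
    rw [hEj _ _ _ (Finset.ne_of_mem_erase hj), hEj _ _ _ (Finset.ne_of_mem_erase hj)]
  rw [← E.sum_comp, ← E.sum_comp, Fintype.sum_prod_type_right, Fintype.sum_prod_type_right]
  refine Finset.sum_congr rfl fun y _ => ?_
  simp only [hEi, hupd, ← Finset.mul_prod_erase _ _ (Finset.mem_univ i)]
  simp only [hprod _ y, mul_ite, mul_zero, Finset.sum_ite_eq', Finset.mem_univ, if_true,
    ← Finset.sum_mul, h, one_mul]

theorem IsCompleteInfoPrior.sum_signal {μ : Θ × Sig Θ I → ℝ} (hμ : IsCompleteInfoPrior μ)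
    (i : Fin I) (θ : Θ) (G : Θ × Sig Θ I → ℝ) :
    ∑ p : Θ × Sig Θ I, (if p.2 i = θ then μ p else 0) * G p =
      margSig μ i θ * G (θ, fun _ => θ) := by
  have h0 : ∀ p : Θ × Sig Θ I, p ≠ (θ, fun _ => θ) → (if p.2 i = θ then μ p else 0) = 0 := by
    rintro ⟨θ', s⟩ hp
    split_ifs with h
    · refine hμ.2 _ _ fun hs => hp ?_
      subst hs
      simp only at h
      rw [h]
    · rfl
  unfold margSig
  rw [Finset.sum_eq_single (θ, fun _ => θ) (fun p _ hp => by rw [h0 p hp, zero_mul]) (by simp),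
    Finset.sum_eq_single (θ, fun _ => θ) (fun p _ hp => h0 p hp) (by simp)]

theorem IsCompleteInfoPrior.interimPay_eq {μ : Θ × Sig Θ I → ℝ} (hμ : IsCompleteInfoPrior μ)
    {σ : ∀ i, Θ → 𝓜.M i → ℝ} (hσ : IsBayesStrategy 𝓜 σ) (i : Fin I) (θ : Θ) (z : 𝓜.M i) :
    interimPay w 𝓜 μ σ i θ z =
      ∑ m : ∀ j, 𝓜.M j, (∏ j, σ j θ (m j)) * payoffS w 𝓜 θ i (Function.update m i z) := by
  rw [← sum_prod_erase_ite (fun j => σ j θ) i (hσ i θ).2]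
  unfold interimPay
  simp only [← Finset.mul_sum]
  rw [hμ.sum_signal i θ fun p => ∑ m : ∀ j, 𝓜.M j,
    (∏ j ∈ Finset.univ.erase i, σ j (p.2 j) (m j)) * (if m i = z then payoffS w 𝓜 p.1 i m else 0),
    mul_div_cancel_left₀ _ (hμ.1.2.2 i θ).ne']

theorem IsBNE.undominatedSets {μ : Θ × Sig Θ I → ℝ} (hμ : IsCompleteInfoPrior μ)
    {σ : ∀ i, Θ → 𝓜.M i → ℝ} (hσ : IsBNE w 𝓜 μ σ) (θ : Θ) :
    UndominatedSets (payoffS w 𝓜 θ) fun i => {x | 0 < σ i θ x} := by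
  intro i x hx x' hdom m hm hmi
  have hle : ∀ m : ∀ j, 𝓜.M j,
      (∏ j, σ j θ (m j)) * payoffS w 𝓜 θ i (Function.update m i x) ≤
        (∏ j, σ j θ (m j)) * payoffS w 𝓜 θ i (Function.update m i x') := by
    intro m
    by_cases hpos : ∀ j, 0 < σ j θ (m j)
    · refine mul_le_mul_of_nonneg_left ?_ (Finset.prod_nonneg fun j _ => (hpos j).le)
      have := hdom (Function.update m i x) (fun k => ?_) (by simp)
      · simpa using this
      · rcases eq_or_ne k i with rfl | hk
        · simpa using hx
        · simpa [hk] using hpos k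
    · push Not at hpos
      obtain ⟨j, hj⟩ := hpos
      rw [Finset.prod_eq_zero (Finset.mem_univ j) (le_antisymm hj ((hσ.1 j θ).1 _))]
      simp
  have hge := hσ.2 i θ x hx x'
  rw [hμ.interimPay_eq hσ.1, hμ.interimPay_eq hσ.1] at hge
  have heq := (Finset.sum_eq_sum_iff_of_le fun m _ => hle m).1
    (le_antisymm (Finset.sum_le_sum fun m _ => hle m) hge) m (Finset.mem_univ m)
  have hpos : 0 < ∏ j, σ j θ (m j) := Finset.prod_pos fun j _ => hm j
  have h := mul_left_cancel₀ hpos.ne' heq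
  rw [← h, ← hmi, Function.update_eq_self]

theorem act_eq_amb {σ : ∀ i, Θ → 𝓜.M i → ℝ} (hσ : IsBayesStrategy 𝓜 σ) {s : Sig Θ I}
    {x : OutcS A I} (h : ∀ m, (∀ i, 0 < σ i (s i) (m i)) → 𝓜.g m = x ∧ ∀ i, 𝓜.τ i m = 0) :
    act 𝓜 σ s = amb x := by
  have hsum : ∀ (G : (∀ i, 𝓜.M i) → ℝ) (c : ℝ), (∀ m, (∀ i, 0 < σ i (s i) (m i)) → G m = c) →
      ∑ m : ∀ i, 𝓜.M i, (∏ j, σ j (s j) (m j)) * G m = c := by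
    intro G c hG
    have h1 : ∀ m : ∀ i, 𝓜.M i, (∏ j, σ j (s j) (m j)) * G m = (∏ j, σ j (s j) (m j)) * c := by
      intro m
      by_cases hpos : ∀ j, 0 < σ j (s j) (m j)
      · rw [hG m hpos]
      · push Not at hpos
        obtain ⟨j, hj⟩ := hpos
        rw [Finset.prod_eq_zero (Finset.mem_univ j) (le_antisymm hj ((hσ j (s j)).1 _))]
        simp
    rw [Finset.sum_congr rfl fun m _ => h1 m, ← Finset.sum_mul,
      sum_prod_eq_one (ρ := fun i => σ i (s i)) fun i => (hσ i (s i)).2, one_mul]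
  refine Prod.ext (funext fun a => hsum _ _ fun m hm => ?_)
    (funext fun i => hsum _ _ fun m hm => ?_)
  · rw [(h m hm).1, amb]
  · rw [(h m hm).1, (h m hm).2 i, add_zero, amb]

theorem tendsto_apply_of_priorDist {ν : ℕ → Θ × Sig Θ I → ℝ} {μ : Θ × Sig Θ I → ℝ}
    (h : Filter.Tendsto (fun n => priorDist (ν n) μ) Filter.atTop (nhds 0)) (p : Θ × Sig Θ I) :
    Filter.Tendsto (fun n => ν n p) Filter.atTop (nhds (μ p)) := by
  rw [← tendsto_sub_nhds_zero_iff]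
  exact squeeze_zero_norm
    (fun n => le_ciSup (f := fun p => |ν n p - μ p|) (Set.finite_range _).bddAbove p) h

theorem tendsto_interimPay {ν : ℕ → Θ × Sig Θ I → ℝ} {μ : Θ × Sig Θ I → ℝ} (hμ : IsPrior μ)
    (hν : ∀ p, Filter.Tendsto (fun n => ν n p) Filter.atTop (nhds (μ p)))
    {σ : ℕ → ∀ i, Θ → 𝓜.M i → ℝ} {σ₀ : ∀ i, Θ → 𝓜.M i → ℝ}
    (hσ : ∀ i s x, Filter.Tendsto (fun n => σ n i s x) Filter.atTop (nhds (σ₀ i s x)))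
    (i : Fin I) (s : Θ) (x : 𝓜.M i) :
    Filter.Tendsto (fun n => interimPay w 𝓜 (ν n) (σ n) i s x) Filter.atTop
      (nhds (interimPay w 𝓜 μ σ₀ i s x)) := by
  have hite : ∀ p : Θ × Sig Θ I, Filter.Tendsto (fun n => if p.2 i = s then ν n p else 0)
      Filter.atTop (nhds (if p.2 i = s then μ p else 0)) := by
    intro p
    split_ifs
    · exact hν p
    · exact tendsto_const_nhds
  refine Filter.Tendsto.div (tendsto_finsetSum _ fun p _ => tendsto_finsetSum _ fun m _ =>
    (hite p).mul ((tendsto_finsetProd _ fun j _ => hσ _ _ _).mul_const _))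
    (tendsto_finsetSum _ fun p _ => hite p) (hμ.2.2 i s).ne.symm

/-- If all equilibria in the limit game induce the same outcome at `s`, then the equilibrium
acts of nearby games converge to it. -/
theorem tendsto_act_of_isBNE {ν : ℕ → Θ × Sig Θ I → ℝ} {μ : Θ × Sig Θ I → ℝ} (hμ : IsPrior μ)
    (hν : ∀ p, Filter.Tendsto (fun n => ν n p) Filter.atTop (nhds (μ p)))
    {σ : ℕ → ∀ i, Θ → 𝓜.M i → ℝ} (hσ : ∀ n, IsBNE w 𝓜 (ν n) (σ n)) {s : Sig Θ I}
    {y : (A → ℝ) × (Fin I → ℝ)} (hy : ∀ σ₀, IsBNE w 𝓜 μ σ₀ → act 𝓜 σ₀ s = y) :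
    Filter.Tendsto (fun n => act 𝓜 (σ n) s) Filter.atTop (nhds y) := by
  refine Filter.tendsto_of_subseq_tendsto fun ns hns => ?_
  have hcomp : IsCompact {σ : ∀ i, Θ → 𝓜.M i → ℝ | IsBayesStrategy 𝓜 σ} := by
    have := isCompact_univ_pi fun i : Fin I => isCompact_univ_pi fun _ : Θ =>
      isCompact_stdSimplex ℝ (𝓜.M i)
    convert this using 1
    ext σ
    simp [IsBayesStrategy, stdSimplex]
  obtain ⟨σ₀, hσ₀, ms, hms, hlim⟩ := hcomp.tendsto_subseq fun n => (hσ (ns n)).1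
  refine ⟨ms, ?_⟩
  have hlim' : ∀ i s x, Filter.Tendsto (fun n => σ (ns (ms n)) i s x) Filter.atTop
      (nhds (σ₀ i s x)) := fun i s x =>
    tendsto_pi_nhds.1 (tendsto_pi_nhds.1 (tendsto_pi_nhds.1 hlim i) s) x
  have hν' : ∀ p, Filter.Tendsto (fun n => ν (ns (ms n)) p) Filter.atTop (nhds (μ p)) :=
    fun p => (hν p).comp (hns.comp hms.tendsto_atTop)
  have hBNE : IsBNE w 𝓜 μ σ₀ := by
    refine ⟨hσ₀, fun i s x hx x' => ?_⟩
    refine le_of_tendsto_of_tendsto (tendsto_interimPay hμ hν' hlim' i s x')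
      (tendsto_interimPay hμ hν' hlim' i s x) ?_
    filter_upwards [(hlim' i s x).eventually_const_lt hx] with n hn
    exact (hσ _).2 i s x hn x'
  rw [← hy σ₀ hBNE]
  exact Filter.Tendsto.prodMk_nhds
    (tendsto_pi_nhds.2 fun a => tendsto_finsetSum _ fun m _ =>
      (tendsto_finsetProd _ fun j _ => hlim' _ _ _).mul_const _)
    (tendsto_pi_nhds.2 fun i => tendsto_finsetSum _ fun m _ =>
      (tendsto_finsetProd _ fun j _ => hlim' _ _ _).mul_const _)

end Equilibria

/-! ### Implementation -/

section Implementation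

variable [Finite Θ] [Fintype A]

/-- A mechanism in which undominated message sets only lead to the desired outcomes, without
transfers. -/
theorem exists_mechanism [Nonempty A] (hI : 2 ≤ I) (w : Fin I → A → Θ → ℝ) (f : Θ → OutcS A I)
    (hf : MaskinMonotoneS w f) :
    ∃ 𝓜 : FinMechS A I, ∀ (θ : Θ) (S : ∀ i, Set (𝓜.M i)), UndominatedSets (payoffS w 𝓜 θ) S →
      ∀ m, (∀ k, m k ∈ S k) → 𝓜.g m = f θ ∧ ∀ i, 𝓜.τ i m = 0 := by
  rcases isEmpty_or_nonempty Θ with hΘ | hΘ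
  · exact ⟨⟨fun _ => Unit, inferInstance, inferInstance,
      fun _ => (⟨Pi.single (Classical.arbitrary A) 1, single_mem_stdSimplex ℝ _⟩, 0), 0⟩,
      fun θ => isEmptyElim θ⟩
  set c : Fin I → Θ → ℝ := fun i θ => (∑ a, w i a θ) / Fintype.card A
  set p : Θ → Fin I → A → ℝ := fun θ i a => w i a θ - c i θ with hp
  have hutil : ∀ i x θ, uS w i x θ = util (p θ i) i x + c i θ := by
    intro i x θ
    have : ∑ a, (x.1 : A → ℝ) a = 1 := x.1.2.2
    simp only [uS, util, hp, mul_sub, Finset.sum_sub_distrib, ← Finset.sum_mul, this]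
    ring
  set t : Set.range p → Fin I → A → ℝ := Subtype.val with ht
  have ht0 : ∀ b i, ∑ x, t b i x = 0 := by
    rintro ⟨-, θ, rfl⟩ i
    have hA : (Fintype.card A : ℝ) ≠ 0 := by simp
    simp only [ht, hp, Finset.sum_sub_distrib, Finset.sum_const, Finset.card_univ, nsmul_eq_mul]
    rw [mul_div_cancel₀ _ hA, sub_self]
  choose r hr using fun b : Set.range p => b.2
  have htr : ∀ b, p (r b) = t b := hr
  set F : Set.range p → OutcS A I := fun b => f (r b) with hF
  have hFf : ∀ (b : Set.range p) (θ : Θ),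
      (∀ j, ¬ Challenges t F j b ⟨p θ, θ, rfl⟩) → F b = f θ := by
    intro b θ hb
    by_contra hne
    obtain ⟨i, x, h1, h2⟩ := hf (r b) θ hne
    rw [hutil, hutil, htr] at h1
    rw [hutil, hutil] at h2
    exact hb i ⟨x, by linarith, by linarith⟩
  obtain ⟨C⟩ := exists_challengeScheme t ht0 F
  obtain ⟨g, hg⟩ := exists_isContestOutcome (by omega) C
  obtain ⟨K, hK⟩ := Finite.exists_le
    fun z : Set.range p × Fin I × (Fin I → Set.range p × Set.range p) =>
      |util (t z.1 z.2.1) z.2.1 (g z.2.2)|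
  have hK' : ∀ q j m, |util (t q j) j (g m)| ≤ |K| :=
    fun q j m => (hK (q, j, m)).trans (le_abs_self K)
  set η' : ℝ := 2 * |K| + 1
  set η : ℝ := I * η' + 2 * |K| + 1
  have : Nonempty (Set.range p) := ⟨⟨p (Classical.arbitrary Θ), _, rfl⟩⟩
  refine ⟨⟨fun _ => Set.range p × Set.range p, fun _ => Fintype.ofFinite _, fun _ => inferInstance,
    g, fun i => score t η η' i⟩, fun θ S hS m hm => ?_⟩
  have hS' : UndominatedSets (M := fun _ => Set.range p × Set.range p)
      (contestPay t g η η' ⟨p θ, θ, rfl⟩) S := by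
    intro i x hx x' hdom m hm hmi
    have key : ∀ m, payoffS w ⟨fun _ => Set.range p × Set.range p, fun _ => Fintype.ofFinite _,
        fun _ => inferInstance, g, fun i => score t η η' i⟩ θ i m =
        contestPay t g η η' ⟨p θ, θ, rfl⟩ i m + c i θ := by
      intro m
      simp only [payoffS, contestPay, hutil, ht]
      ring
    have h := hS i x hx x' (fun m hm hmi => by
      rw [key, key]
      exact add_le_add_left (hdom m hm hmi) _) m hm hmi
    rw [key, key] at h
    exact le_of_add_le_add_right h
  obtain ⟨b, hb, hbq⟩ := hS'.exists_quietAt hg (hK' _) (abs_nonneg K) (lt_add_one _)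
    (lt_add_one _) hI Subtype.val_injective hm
  exact ⟨(hg.1 m b hb).trans (hFf b θ hbq), fun i => hb.score_eq_zero η η' i⟩

end Implementation

/-- **Proposition 3**: every Maskin-monotonic SCF is `N̄E`-implementable, i.e.,
implementable robustly to vanishing information perturbations of complete information. -/
theorem robust_implementation
    [Fintype Θ] [Fintype A] [Nonempty A] (hI : 2 ≤ I)
    (w : Fin I → A → Θ → ℝ) (f : Θ → OutcS A I) (hf : MaskinMonotoneS w f) :
    ∃ 𝓜 : FinMechS A I,
      ∀ μ : Θ × Sig Θ I → ℝ, IsCompleteInfoPrior μ →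
      ∀ (θ : Θ) (s : Sig Θ I), 0 < μ (θ, s) →
      ∀ ν : ℕ → (Θ × Sig Θ I → ℝ), (∀ n, IsPrior (ν n)) →
        Filter.Tendsto (fun n => priorDist (ν n) μ) Filter.atTop (nhds 0) →
        (∃ σ : ℕ → ∀ i, Θ → 𝓜.M i → ℝ,
            (∀ n, IsBNE w 𝓜 (ν n) (σ n)) ∧
            Filter.Tendsto (fun n => act 𝓜 (σ n) s) Filter.atTop (nhds (amb (f θ)))) ∧
        (∀ σ : ℕ → ∀ i, Θ → 𝓜.M i → ℝ,
            (∀ n, IsBNE w 𝓜 (ν n) (σ n)) →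
            Filter.Tendsto (fun n => act 𝓜 (σ n) s) Filter.atTop (nhds (amb (f θ)))) := by
  obtain ⟨𝓜, h𝓜⟩ := exists_mechanism hI w f hf
  refine ⟨𝓜, fun μ hμ θ s hs ν hν hlim => ?_⟩
  obtain rfl : s = fun _ => θ := by
    by_contra hne
    exact hs.ne' (hμ.2 θ s hne)
  have hconv : ∀ σ : ℕ → ∀ i, Θ → 𝓜.M i → ℝ, (∀ n, IsBNE w 𝓜 (ν n) (σ n)) →
      Filter.Tendsto (fun n => act 𝓜 (σ n) fun _ => θ) Filter.atTop (nhds (amb (f θ))) :=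
    fun σ hσ => tendsto_act_of_isBNE hμ.1 (tendsto_apply_of_priorDist hlim) hσ fun σ₀ hσ₀ =>
      act_eq_amb hσ₀.1 fun m hm => h𝓜 θ _ (hσ₀.undominatedSets hμ θ) m hm
  choose σ hσ using fun n => exists_isBNE w 𝓜 (ν n)
  exact ⟨⟨σ, hσ, hconv σ hσ⟩, hconv⟩

end
end
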